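/- Suppose b satisfies Assumption 1 with ρ ∈ (1,2) and Assumption 2, and adopt the spectral setup. Let T > 0, 0 < s ≤ 1/ρ and γ < ρs/2. Then there exists C = C(T,γ,ρ) > 0 such that for every n ≥ 1, with Δt := T/n, t_k := kΔt, B_0 := I and B_k x := ∫₀^∞ S(Δt u)x · e^{−u} u^{k−1}/(k−1)! du for k ≥ 1, and every x ∈ H: (Δt Σ_{k=0}^n ‖S(t_k)x − B_k x‖²)^{1/2} ≤ C Δt^γ ‖x‖_{s − 1/ρ}. -/

import Mathlib

open MeasureTheory Filter Set
open scoped ENNReal NNReal RealInnerProductSpace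

noncomputable section

/-- The Laplace transform `b̂(z) = ∫₀^∞ e^{-zt} b(t) dt` of a real-valued kernel `b`. -/
def laplaceTransform (b : ℝ → ℝ) (z : ℂ) : ℂ :=
  ∫ t in Set.Ioi (0 : ℝ), Complex.exp (-z * t) * (b t : ℂ)

/-- Assumption 1: `b` is a nonzero, locally integrable, 3-monotone kernel
(with derivative `b'` on `(0,∞)`), `b(t) → 0` as `t → ∞`, and the angle condition
`ρ = 1 + (2/π) sup{|arg b̂(λ)| : Re λ > 0} ∈ (1,2)` holds. -/
structure Assumption1 (b b' : ℝ → ℝ) (ρ : ℝ) : Prop where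
  locInt : ∀ T > 0, IntegrableOn b (Set.Ioc 0 T)
  ne_zero : ∃ t > 0, b t ≠ 0
  nonneg : ∀ t > 0, 0 ≤ b t
  anti : AntitoneOn b (Set.Ioi 0)
  cvx : ConvexOn ℝ (Set.Ioi 0) b
  hasDeriv : ∀ t > 0, HasDerivAt b (b' t) t
  deriv_nonpos : ∀ t > 0, b' t ≤ 0
  deriv_anti : AntitoneOn (fun t => -(b' t)) (Set.Ioi 0)
  deriv_cvx : ConvexOn ℝ (Set.Ioi 0) (fun t => -(b' t))
  tendsto_zero : Tendsto b atTop (nhds 0)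
  rho_eq : ρ = 1 + (2 / Real.pi) *
      sSup {θ : ℝ | ∃ z : ℂ, 0 < z.re ∧ θ = |(laplaceTransform b z).arg|}
  rho_mem : ρ ∈ Set.Ioo (1 : ℝ) 2

/-- Assumption 2: `b̂` extends analytically to a sector `Σ_θ`, `θ > π/2`, with the
bounds `|b̂^{(k)}(z)| ≤ C |z|^{1-ρ-k}`, `k = 0,1`, there. -/
structure Assumption2 (b : ℝ → ℝ) (ρ θ : ℝ) : Prop where
  theta_gt : Real.pi / 2 < θ
  holo : ∃ B : ℂ → ℂ,
    (∀ z : ℂ, z ≠ 0 → |z.arg| < θ → DifferentiableAt ℂ B z) ∧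
    (∀ z : ℂ, 0 < z.re → B z = laplaceTransform b z) ∧
    ∃ C > 0, (∀ z : ℂ, z ≠ 0 → |z.arg| < θ → ‖B z‖ ≤ C * ‖z‖ ^ (1 - ρ)) ∧
      (∀ z : ℂ, z ≠ 0 → |z.arg| < θ → ‖deriv B z‖ ≤ C * ‖z‖ ^ (-ρ))

/-- `s` (with derivative `s'` on `(0,∞)`) solves the scalar Volterra equation
`s'(t) + λ ∫₀ᵗ b(t-u) s(u) du = 0`, `s(0) = 1`. -/
structure IsScalarSolution (b : ℝ → ℝ) (lam : ℝ) (s s' : ℝ → ℝ) : Prop where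
  init : s 0 = 1
  cont : ContinuousOn s (Set.Ici 0)
  hasDeriv : ∀ t > 0, HasDerivAt s (s' t) t
  eqn : ∀ t > 0, s' t + lam * ∫ u in (0 : ℝ)..t, b (t - u) * s u = 0

/-- The resolvent family `S(t)x = Σ_k s_k(t) (x,e_k) e_k`. -/
def Sop {H : Type*} [NormedAddCommGroup H] [InnerProductSpace ℝ H]
    (e : HilbertBasis ℕ ℝ H) (s : ℕ → ℝ → ℝ) (t : ℝ) (x : H) : H :=
  ∑' k, (s k t * ⟪x, e k⟫) • (e k : H)

/-- The Backward Euler convolution quadrature operator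
`B_k = ∫₀^∞ F(Δt s) e^{-s} s^{k-1}/(k-1)! ds`. -/
def quadB {H : Type*} [NormedAddCommGroup H] [NormedSpace ℝ H]
    (Δt : ℝ) (F : ℝ → H) (k : ℕ) : H :=
  ∫ u in Set.Ioi (0 : ℝ),
    (Real.exp (-u) * u ^ (k - 1) / (Nat.factorial (k - 1) : ℝ)) • F (Δt * u)

/-- The finite element setup: `f` is an orthonormal basis of the finite dimensional
subspace `V_h ⊆ D(A^{1/2})`, consisting of eigenvectors of the discrete operator `A_h`
(defined via the bilinear form `a(u,v) = Σ_k λ_k (u,e_k)(v,e_k)`) with positive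
eigenvalues `μ`. -/
structure FESetup {H : Type*} [NormedAddCommGroup H] [InnerProductSpace ℝ H]
    (e : HilbertBasis ℕ ℝ H) (lam : ℕ → ℝ) (N : ℕ) (f : Fin N → H) (μ : Fin N → ℝ) :
    Prop where
  f_orth : Orthonormal ℝ f
  mu_pos : ∀ j, 0 < μ j
  f_dom : ∀ j, (∑' k, ENNReal.ofReal (lam k * ⟪f j, e k⟫ ^ 2)) < ⊤
  eigen : ∀ j j', (∑' k, lam k * ⟪f j, e k⟫ * ⟪f j', e k⟫) = μ j * ⟪f j, f j'⟫

/-- A function integrable on the half line stays so after multiplication by sine. -/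
lemma integrableOn_mul_sin {D : ℝ → ℝ} (hD : IntegrableOn D (Ioi 0)) :
    IntegrableOn (fun t => D t * Real.sin t) (Ioi 0) :=
  hD.mul_bdd (c := 1) Real.continuous_sin.aestronglyMeasurable
    (Eventually.of_forall fun t => by simpa using Real.abs_sin_le_one t)

lemma integrableOn_mul_cos {D : ℝ → ℝ} (hD : IntegrableOn D (Ioi 0)) :
    IntegrableOn (fun t => D t * Real.cos t) (Ioi 0) :=
  hD.mul_bdd (c := 1) Real.continuous_cos.aestronglyMeasurable
    (Eventually.of_forall fun t => by simpa using Real.abs_cos_le_one t)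

lemma intervalIntegrable_of_integrableOn_Ioi {f : ℝ → ℝ} (hf : IntegrableOn f (Ioi 0))
    {a c : ℝ} (ha : 0 ≤ a) (hc : 0 ≤ c) : IntervalIntegrable f volume a c := by
  rw [intervalIntegrable_iff]
  refine hf.mono_set fun t ht => ?_
  exact lt_of_le_of_lt (le_min ha hc) ht.1

lemma setIntegral_Ioi_add_shift (f : ℝ → ℝ) (a : ℝ) :
    ∫ t in Ioi (0 : ℝ), f (t + a) = ∫ t in Ioi a, f t := by
  have h := (measurePreserving_add_right volume a).setIntegral_preimage_emb
    (measurableEmbedding_addRight a) f (Ioi a)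
  simpa using h

lemma integrableOn_comp_add {f : ℝ → ℝ} (hf : IntegrableOn f (Ioi 0)) {a : ℝ} (ha : 0 ≤ a) :
    IntegrableOn (fun t => f (t + a)) (Ioi 0) := by
  have h := (measurePreserving_add_right volume a).integrableOn_comp_preimage
    (measurableEmbedding_addRight a) (f := f) (s := Ioi a)
  have h2 := h.2 (hf.mono_set (Ioi_subset_Ioi ha))
  simpa [Function.comp_def] using h2

/-- The sine transform of an antitone integrable function is nonnegative. -/
lemma integral_mul_sin_nonneg {D : ℝ → ℝ} (hanti : AntitoneOn D (Ioi 0))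
    (hint : IntegrableOn D (Ioi 0)) : 0 ≤ ∫ t in Ioi (0 : ℝ), D t * Real.sin t := by
  have hs := integrableOn_mul_sin hint
  have hlim := intervalIntegral_tendsto_integral_Ioi 0 hs
    (tendsto_natCast_atTop_atTop.atTop_mul_const (mul_pos two_pos Real.pi_pos) :
      Tendsto (fun n : ℕ => (n : ℝ) * (2 * Real.pi)) atTop atTop)
  refine ge_of_tendsto' hlim fun n => ?_
  have hpi := Real.pi_pos
  induction n with
  | zero => simp
  | succ n ih =>
    set a : ℝ := (n : ℝ) * (2 * Real.pi) with ha
    have ha0 : 0 ≤ a := by positivity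
    have e1 : ((n + 1 : ℕ) : ℝ) * (2 * Real.pi) = a + Real.pi + Real.pi := by
      rw [ha]; push_cast; ring
    have ii : ∀ c d : ℝ, 0 ≤ c → 0 ≤ d →
        IntervalIntegrable (fun t => D t * Real.sin t) volume c d :=
      fun c d hc hd => intervalIntegrable_of_integrableOn_Ioi hs hc hd
    rw [e1, ← intervalIntegral.integral_add_adjacent_intervals (ii 0 a le_rfl ha0)
      (ii a _ ha0 (by positivity)),
      ← intervalIntegral.integral_add_adjacent_intervals (ii a (a + Real.pi) ha0 (by positivity))
      (ii (a + Real.pi) _ (by positivity) (by positivity))]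
    refine add_nonneg ih ?_
    have e2 : ∫ t in (a + Real.pi)..(a + Real.pi + Real.pi), D t * Real.sin t =
        ∫ t in a..(a + Real.pi), D (t + Real.pi) * Real.sin (t + Real.pi) :=
      (intervalIntegral.integral_comp_add_right
        (fun t => D t * Real.sin t) Real.pi).symm
    have hs' : IntegrableOn (fun t => D (t + Real.pi) * Real.sin (t + Real.pi)) (Ioi 0) :=
      integrableOn_comp_add hs hpi.le
    rw [e2, ← intervalIntegral.integral_add (ii _ _ ha0 (by positivity))
      (intervalIntegrable_of_integrableOn_Ioi hs' ha0 (by positivity))]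
    refine intervalIntegral.integral_nonneg (by linarith) fun t ht => ?_
    rw [Real.sin_add_pi]
    have hsin : 0 ≤ Real.sin t := by
      have : Real.sin t = Real.sin (t - a) := by
        rw [ha, Real.sin_sub_nat_mul_two_pi]
      rw [this]
      exact Real.sin_nonneg_of_nonneg_of_le_pi (by linarith [ht.1]) (by linarith [ht.2])
    rcases eq_or_lt_of_le (ha0.trans ht.1) with h0 | h0
    · simp [← h0]
    · have := hanti (mem_Ioi.2 h0) (mem_Ioi.2 (by linarith : 0 < t + Real.pi)) (by linarith)
      nlinarith

lemma integral_mul_sin_shift_pi {D : ℝ → ℝ} (hint : IntegrableOn D (Ioi 0)) :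
    ∫ t in Ioi (0 : ℝ), D (t + Real.pi) * Real.sin t =
      (∫ t in (0 : ℝ)..Real.pi, D t * Real.sin t) - ∫ t in Ioi (0 : ℝ), D t * Real.sin t := by
  have hs := integrableOn_mul_sin hint
  have h1 := setIntegral_Ioi_add_shift (fun t => D t * Real.sin t) Real.pi
  simp only [Real.sin_add_pi, mul_neg, integral_neg] at h1
  have h2 := intervalIntegral.integral_Ioi_sub_Ioi hs Real.pi_pos.le
  linarith

/-- For a convex function, the first half period carries at most twice the sine transform. -/
lemma integral_half_period_le {β : ℝ → ℝ} (hconv : ConvexOn ℝ (Ioi 0) β)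
    (hint : IntegrableOn β (Ioi 0)) :
    ∫ t in (0 : ℝ)..Real.pi, β t * Real.sin t ≤ 2 * ∫ t in Ioi (0 : ℝ), β t * Real.sin t := by
  have hpi := Real.pi_pos
  have hsh := integrableOn_comp_add hint hpi.le
  have hanti : AntitoneOn (fun t => β t - β (t + Real.pi)) (Ioi 0) := by
    intro x hx y hy hxy
    have hx' : (0 : ℝ) < x := hx
    have hy' : (0 : ℝ) < y := hy
    rcases eq_or_lt_of_le hxy with rfl | hlt
    · exact le_rfl
    have m1 : (y - x) / (y - x + Real.pi) + Real.pi / (y - x + Real.pi) = 1 := by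
      field_simp
    have hpos : 0 < y - x + Real.pi := by linarith
    have hyp : (y + Real.pi) ∈ Ioi (0 : ℝ) := by simp only [mem_Ioi]; linarith
    have c1 := hconv.2 hx hyp (div_nonneg (by linarith) hpos.le : 0 ≤ (y - x) / (y - x + Real.pi))
      (div_nonneg hpi.le hpos.le : 0 ≤ Real.pi / (y - x + Real.pi)) m1
    have c2 := hconv.2 hx hyp (div_nonneg hpi.le hpos.le : 0 ≤ Real.pi / (y - x + Real.pi))
      (div_nonneg (by linarith) hpos.le : 0 ≤ (y - x) / (y - x + Real.pi))
      (by rw [add_comm]; exact m1)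
    have e1 : ((y - x) / (y - x + Real.pi)) • x + (Real.pi / (y - x + Real.pi)) • (y + Real.pi) =
        x + Real.pi := by
      simp only [smul_eq_mul]; field_simp; ring
    have e2 : (Real.pi / (y - x + Real.pi)) • x + ((y - x) / (y - x + Real.pi)) • (y + Real.pi) =
        y := by
      simp only [smul_eq_mul]; field_simp; ring
    rw [e1] at c1
    rw [e2] at c2
    simp only [smul_eq_mul] at c1 c2
    have e3 : β x = (y - x) / (y - x + Real.pi) * β x + Real.pi / (y - x + Real.pi) * β x := by
      rw [← add_mul, m1, one_mul]
    have e4 : β (y + Real.pi) = (y - x) / (y - x + Real.pi) * β (y + Real.pi) +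
        Real.pi / (y - x + Real.pi) * β (y + Real.pi) := by
      rw [← add_mul, m1, one_mul]
    show β y - β (y + Real.pi) ≤ β x - β (x + Real.pi)
    linarith
  have h := integral_mul_sin_nonneg hanti (hint.sub hsh)
  simp only [sub_mul] at h
  rw [integral_sub (integrableOn_mul_sin hint) (integrableOn_mul_sin hsh),
    integral_mul_sin_shift_pi hint] at h
  linarith

/-- The sine transform is bounded by the contribution of the first half period. -/
lemma integral_mul_sin_le {D : ℝ → ℝ} (hanti : AntitoneOn D (Ioi 0))
    (hint : IntegrableOn D (Ioi 0)) :
    ∫ t in Ioi (0 : ℝ), D t * Real.sin t ≤ ∫ t in (0 : ℝ)..Real.pi, D t * Real.sin t := by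
  have hpi := Real.pi_pos
  have h := integral_mul_sin_nonneg (D := fun t => D (t + Real.pi)) (fun x hx y hy hxy =>
    hanti (mem_Ioi.2 (by linarith [mem_Ioi.1 hx])) (mem_Ioi.2 (by linarith [mem_Ioi.1 hy]))
      (by linarith)) (integrableOn_comp_add hint hpi.le)
  rw [integral_mul_sin_shift_pi hint] at h
  linarith

/-- Lower bound for the Fourier transform of a convex decreasing function at frequency one. -/
lemma cos_one_mul_integral_le {β : ℝ → ℝ} (hnonneg : ∀ t > 0, 0 ≤ β t)
    (hanti : AntitoneOn β (Ioi 0)) (hconv : ConvexOn ℝ (Ioi 0) β)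
    (hint : IntegrableOn β (Ioi 0)) :
    Real.cos 1 * ∫ t in (0 : ℝ)..1, β t ≤
      (∫ t in Ioi (0 : ℝ), β t * Real.cos t) + 4 * ∫ t in Ioi (0 : ℝ), β t * Real.sin t := by
  have hpi := Real.pi_gt_three
  have hc := integrableOn_mul_cos hint
  have hs := integrableOn_mul_sin hint
  have hp2 : (0 : ℝ) < Real.pi / 2 := by linarith
  have hsplit := intervalIntegral.integral_Ioi_sub_Ioi hc hp2.le
  have hshift := setIntegral_Ioi_add_shift (fun t => β t * Real.cos t) (Real.pi / 2)
  simp only [Real.cos_add_pi_div_two, mul_neg, integral_neg] at hshift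
  have hantis : AntitoneOn (fun t => β (t + Real.pi / 2)) (Ioi 0) := fun x hx y hy hxy =>
    hanti (mem_Ioi.2 (by linarith [mem_Ioi.1 hx])) (mem_Ioi.2 (by linarith [mem_Ioi.1 hy]))
      (by linarith)
  have hints := integrableOn_comp_add hint hp2.le
  have htail := integral_mul_sin_le hantis hints
  have htail2 : ∫ t in (0 : ℝ)..Real.pi, β (t + Real.pi / 2) * Real.sin t ≤
      ∫ t in (0 : ℝ)..Real.pi, β (Real.pi / 2) * Real.sin t := by
    refine intervalIntegral.integral_mono_on (by linarith)
      (intervalIntegrable_of_integrableOn_Ioi (integrableOn_mul_sin hints) le_rfl (by linarith))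
      (Continuous.intervalIntegrable (by fun_prop) _ _) fun t ht => ?_
    refine mul_le_mul_of_nonneg_right (hanti (mem_Ioi.2 hp2) ?_ (by linarith [ht.1]))
      (Real.sin_nonneg_of_nonneg_of_le_pi ht.1 ht.2)
    simp only [mem_Ioi]; linarith [ht.1]
  have hval : ∫ t in (0 : ℝ)..Real.pi, β (Real.pi / 2) * Real.sin t = 2 * β (Real.pi / 2) := by
    rw [intervalIntegral.integral_const_mul, integral_sin]; simp; ring
  have hhalf := integral_half_period_le hconv hint
  have ii : ∀ c d : ℝ, 0 ≤ c → 0 ≤ d →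
      IntervalIntegrable (fun t => β t * Real.sin t) volume c d :=
    fun c d hc hd => intervalIntegrable_of_integrableOn_Ioi hs hc hd
  have hlow : β (Real.pi / 2) ≤ ∫ t in (0 : ℝ)..Real.pi, β t * Real.sin t := by
    rw [← intervalIntegral.integral_add_adjacent_intervals (ii 0 (Real.pi / 2) le_rfl hp2.le)
      (ii (Real.pi / 2) _ hp2.le (by linarith))]
    have h1 : ∫ t in (0 : ℝ)..(Real.pi / 2), β (Real.pi / 2) * Real.sin t ≤
        ∫ t in (0 : ℝ)..(Real.pi / 2), β t * Real.sin t := by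
      refine intervalIntegral.integral_mono_on hp2.le
        (Continuous.intervalIntegrable (by fun_prop) _ _) (ii _ _ le_rfl hp2.le) fun t ht => ?_
      rcases eq_or_lt_of_le ht.1 with h0 | h0
      · simp [← h0]
      · exact mul_le_mul_of_nonneg_right (hanti h0 (mem_Ioi.2 hp2) ht.2)
          (Real.sin_nonneg_of_nonneg_of_le_pi ht.1 (by linarith [ht.2]))
    have h2 : ∫ t in (0 : ℝ)..(Real.pi / 2), β (Real.pi / 2) * Real.sin t = β (Real.pi / 2) := by
      rw [intervalIntegral.integral_const_mul, integral_sin]; simp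
    have h3 : 0 ≤ ∫ t in (Real.pi / 2)..Real.pi, β t * Real.sin t :=
      intervalIntegral.integral_nonneg (by linarith) fun t ht =>
        mul_nonneg (hnonneg t (by linarith [ht.1]))
          (Real.sin_nonneg_of_nonneg_of_le_pi (by linarith [ht.1]) ht.2)
    linarith
  have icc : ∀ c d : ℝ, 0 ≤ c → 0 ≤ d →
      IntervalIntegrable (fun t => β t * Real.cos t) volume c d :=
    fun c d hc' hd => intervalIntegrable_of_integrableOn_Ioi hc hc' hd
  have hcos : Real.cos 1 * ∫ t in (0 : ℝ)..1, β t ≤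
      ∫ t in (0 : ℝ)..(Real.pi / 2), β t * Real.cos t := by
    rw [← intervalIntegral.integral_add_adjacent_intervals (icc 0 1 le_rfl zero_le_one)
      (icc 1 _ zero_le_one hp2.le), ← intervalIntegral.integral_const_mul]
    have h1 : ∫ t in (0 : ℝ)..1, Real.cos 1 * β t ≤ ∫ t in (0 : ℝ)..1, β t * Real.cos t := by
      refine intervalIntegral.integral_mono_on_of_le_Ioo zero_le_one
        ((intervalIntegrable_of_integrableOn_Ioi hint le_rfl zero_le_one).const_mul _)
        (icc _ _ le_rfl zero_le_one) fun t ht => ?_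
      rw [mul_comm]
      exact mul_le_mul_of_nonneg_left (Real.cos_le_cos_of_nonneg_of_le_pi ht.1.le (by linarith)
        ht.2.le) (hnonneg t ht.1)
    have h3 : 0 ≤ ∫ t in (1 : ℝ)..(Real.pi / 2), β t * Real.cos t :=
      intervalIntegral.integral_nonneg (by linarith) fun t ht =>
        mul_nonneg (hnonneg t (by linarith [ht.1]))
          (Real.cos_nonneg_of_neg_pi_div_two_le_of_le (by linarith [ht.1]) ht.2)
    linarith
  linarith

section Kernel

variable {b b' : ℝ → ℝ} {ρ : ℝ}

lemma Assumption1.integrableOn_exp_mul (hb : Assumption1 b b' ρ) {x : ℝ} (hx : 0 < x) :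
    IntegrableOn (fun t => Real.exp (-(x * t)) * b t) (Ioi 0) := by
  have hmeas : AEStronglyMeasurable b (volume.restrict (Ioi 0)) :=
    (aemeasurable_restrict_of_antitoneOn measurableSet_Ioi hb.anti).aestronglyMeasurable
  have hexp : Continuous fun t : ℝ => Real.exp (-(x * t)) := by fun_prop
  rw [← Ioc_union_Ioi_eq_Ioi (zero_le_one' ℝ), integrableOn_union]
  constructor
  · refine Integrable.bdd_mul (c := 1) (hb.locInt 1 one_pos) hexp.aestronglyMeasurable ?_
    filter_upwards [ae_restrict_mem measurableSet_Ioc] with t ht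
    rw [Real.norm_eq_abs, Real.abs_exp]
    exact Real.exp_le_one_iff.2 (by have := mul_pos hx ht.1; linarith)
  · refine Integrable.mul_bdd (c := b 1) ?_
      (hmeas.mono_measure (Measure.restrict_mono (Ioi_subset_Ioi zero_le_one) le_rfl)) ?_
    · have := exp_neg_integrableOn_Ioi 1 hx
      simpa [IntegrableOn] using this
    · filter_upwards [ae_restrict_mem measurableSet_Ioi] with t ht
      have h1 : (1 : ℝ) < t := ht
      rw [Real.norm_of_nonneg (hb.nonneg t (by linarith))]
      exact hb.anti (mem_Ioi.2 one_pos) (mem_Ioi.2 (by linarith)) h1.le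

lemma Assumption1.integrableOn_cexp_mul (hb : Assumption1 b b' ρ) {z : ℂ} (hz : 0 < z.re) :
    IntegrableOn (fun t : ℝ => Complex.exp (-z * t) * (b t : ℂ)) (Ioi 0) := by
  have hmeas : AEStronglyMeasurable b (volume.restrict (Ioi 0)) :=
    (aemeasurable_restrict_of_antitoneOn measurableSet_Ioi hb.anti).aestronglyMeasurable
  refine (hb.integrableOn_exp_mul hz).mono' ?_ ?_
  · exact (Continuous.aestronglyMeasurable (by fun_prop)).mul
      (Complex.continuous_ofReal.comp_aestronglyMeasurable hmeas)
  · filter_upwards [ae_restrict_mem measurableSet_Ioi] with t ht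
    rw [norm_mul, Complex.norm_exp, Complex.norm_real, Real.norm_of_nonneg (hb.nonneg t ht)]
    simp

lemma Assumption1.convexOn_exp_mul (hb : Assumption1 b b' ρ) {x : ℝ} (hx : 0 ≤ x) :
    ConvexOn ℝ (Ioi 0) fun t => Real.exp (-(x * t)) * b t := by
  have h1 : ConvexOn ℝ (Ioi (0 : ℝ)) fun t : ℝ => Real.exp (-(x * t)) := by
    have := (convexOn_exp.comp_linearMap (LinearMap.mulLeft ℝ (-x))).subset
      (subset_univ (Ioi (0 : ℝ))) (convex_Ioi 0)
    simpa [Function.comp_def] using this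
  have h2 : AntitoneOn (fun t : ℝ => Real.exp (-(x * t))) (Ioi 0) := fun s _ t _ hst =>
    Real.exp_le_exp.2 (by have := mul_le_mul_of_nonneg_left hst hx; linarith)
  exact h1.mul hb.cvx (fun t _ => (Real.exp_pos _).le) (fun t ht => hb.nonneg t ht)
    (h2.monovaryOn hb.anti)

lemma Assumption1.antitoneOn_exp_mul (hb : Assumption1 b b' ρ) {x : ℝ} (hx : 0 ≤ x) :
    AntitoneOn (fun t => Real.exp (-(x * t)) * b t) (Ioi 0) := fun s hs t ht hst =>
  mul_le_mul (Real.exp_le_exp.2 (by have := mul_le_mul_of_nonneg_left hst hx; linarith))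
    (hb.anti hs ht hst) (hb.nonneg t ht) (Real.exp_pos _).le

lemma Assumption1.laplace_re (hb : Assumption1 b b' ρ) {z : ℂ} (hz : 0 < z.re) :
    (laplaceTransform b z).re =
      ∫ t in Ioi (0 : ℝ), Real.exp (-(z.re * t)) * b t * Real.cos (z.im * t) := by
  have h := integral_re (hb.integrableOn_cexp_mul hz)
  rw [laplaceTransform]
  refine h.symm.trans (integral_congr_ae (Eventually.of_forall fun t => ?_))
  simp only [RCLike.re_to_complex, Complex.mul_re, Complex.ofReal_re, Complex.ofReal_im,
    Complex.exp_re, Complex.mul_im, Complex.neg_re, Complex.neg_im, mul_zero, sub_zero,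
    zero_add, neg_mul, Real.cos_neg]
  ring

lemma Assumption1.laplace_im (hb : Assumption1 b b' ρ) {z : ℂ} (hz : 0 < z.re) :
    (laplaceTransform b z).im =
      -∫ t in Ioi (0 : ℝ), Real.exp (-(z.re * t)) * b t * Real.sin (z.im * t) := by
  have h := integral_im (hb.integrableOn_cexp_mul hz)
  rw [laplaceTransform, ← integral_neg]
  refine h.symm.trans (integral_congr_ae (Eventually.of_forall fun t => ?_))
  simp only [RCLike.im_to_complex, Complex.mul_re, Complex.ofReal_re, Complex.ofReal_im,
    Complex.exp_im, Complex.mul_im, Complex.neg_re, Complex.neg_im, mul_zero, sub_zero,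
    zero_add, neg_mul, Real.sin_neg]
  ring

/-- Lower bound for the Fourier transform of a convex decreasing function at frequency `ω`. -/
lemma cos_one_mul_integral_le_of_pos {k : ℝ → ℝ} (hnonneg : ∀ t > 0, 0 ≤ k t)
    (hanti : AntitoneOn k (Ioi 0)) (hconv : ConvexOn ℝ (Ioi 0) k)
    (hint : IntegrableOn k (Ioi 0)) {ω : ℝ} (hω : 0 < ω) :
    Real.cos 1 * ∫ t in (0 : ℝ)..1 / ω, k t ≤
      (∫ t in Ioi (0 : ℝ), k t * Real.cos (ω * t)) +
        4 * ∫ t in Ioi (0 : ℝ), k t * Real.sin (ω * t) := by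
  have hpos : ∀ t : ℝ, 0 < t → 0 < ω⁻¹ * t := fun t ht => mul_pos (inv_pos.2 hω) ht
  have hcv : ConvexOn ℝ (Ioi 0) fun t => k (ω⁻¹ * t) := by
    have := (hconv.comp_linearMap (LinearMap.mulLeft ℝ ω⁻¹))
    have hs : Ioi (0 : ℝ) ⊆ (LinearMap.mulLeft ℝ ω⁻¹) ⁻¹' Ioi 0 := fun t ht => hpos t ht
    exact this.subset hs (convex_Ioi 0)
  have h := cos_one_mul_integral_le (β := fun t => k (ω⁻¹ * t)) (fun t ht => hnonneg _ (hpos t ht))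
    (fun s hs t ht hst => hanti (hpos s hs) (hpos t ht)
      (mul_le_mul_of_nonneg_left hst (inv_pos.2 hω).le)) hcv
    ((integrableOn_Ioi_comp_mul_left_iff k 0 (inv_pos.2 hω)).2 (by simpa using hint))
  have e1 : ∫ t in (0 : ℝ)..1, k (ω⁻¹ * t) = ω * ∫ t in (0 : ℝ)..1 / ω, k t := by
    rw [intervalIntegral.integral_comp_mul_left _ (inv_pos.2 hω).ne']
    simp
  have e2 : ∀ f : ℝ → ℝ, ∫ t in Ioi (0 : ℝ), k (ω⁻¹ * t) * f t =
      ω * ∫ t in Ioi (0 : ℝ), k t * f (ω * t) := by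
    intro f
    have := integral_comp_mul_left_Ioi (fun t => k t * f (ω * t)) 0 (inv_pos.2 hω)
    simpa [mul_inv_cancel_left₀ hω.ne'] using this
  rw [e1, e2, e2] at h
  refine le_of_mul_le_mul_left ?_ hω
  linarith

/-- The Laplace transform of the kernel controls the mass of the kernel near the origin. -/
lemma Assumption1.integral_le_norm_laplace (hb : Assumption1 b b' ρ) {z : ℂ} (hz : 0 < z.re) :
    Real.cos 1 * (Real.exp (-1) * ∫ t in (0 : ℝ)..1 / ‖z‖, b t) ≤ 5 * ‖laplaceTransform b z‖ := by
  have hz0 : 0 < ‖z‖ := norm_pos_iff.2 fun h => by simp [h] at hz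
  set k : ℝ → ℝ := fun t => Real.exp (-(z.re * t)) * b t with hk
  have hknn : ∀ t > 0, 0 ≤ k t := fun t ht => mul_nonneg (Real.exp_pos _).le (hb.nonneg t ht)
  have hkint : IntegrableOn k (Ioi 0) := hb.integrableOn_exp_mul hz
  have hcos : 0 < Real.cos 1 := Real.cos_one_pos
  have hbint : IntervalIntegrable b volume 0 (1 / ‖z‖) := by
    rw [intervalIntegrable_iff_integrableOn_Ioc_of_le (by positivity)]
    exact hb.locInt _ (by positivity)
  have h1 : Real.exp (-1) * ∫ t in (0 : ℝ)..1 / ‖z‖, b t ≤ ∫ t in (0 : ℝ)..1 / ‖z‖, k t := by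
    rw [← intervalIntegral.integral_const_mul]
    refine intervalIntegral.integral_mono_on_of_le_Ioo (by positivity) (hbint.const_mul _)
      (intervalIntegrable_of_integrableOn_Ioi hkint le_rfl (by positivity)) fun t ht => ?_
    refine mul_le_mul_of_nonneg_right (Real.exp_le_exp.2 (neg_le_neg ?_)) (hb.nonneg t ht.1)
    have h2 : t * ‖z‖ ≤ 1 := by
      have := ht.2.le
      rwa [le_div_iff₀ hz0] at this
    have h3 := mul_le_mul_of_nonneg_right (Complex.re_le_norm z) ht.1.le
    linarith
  have hre := hb.laplace_re hz
  have him := hb.laplace_im hz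
  have hnre := Complex.abs_re_le_norm (laplaceTransform b z)
  have hnim := Complex.abs_im_le_norm (laplaceTransform b z)
  suffices h : Real.cos 1 * ∫ t in (0 : ℝ)..1 / ‖z‖, k t ≤ 5 * ‖laplaceTransform b z‖ from
    (mul_le_mul_of_nonneg_left h1 hcos.le).trans h
  rcases eq_or_ne z.im 0 with h0 | h0
  · have e : ∫ t in (0 : ℝ)..1 / ‖z‖, k t ≤ (laplaceTransform b z).re := by
      rw [hre, h0, intervalIntegral.integral_of_le (by positivity)]
      simp only [zero_mul, Real.cos_zero, mul_one]
      exact setIntegral_mono_set hkint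
        ((ae_restrict_iff' measurableSet_Ioi).2 (Eventually.of_forall hknn))
        (Eventually.of_forall fun t ht => ht.1)
    have e0 : 0 ≤ ∫ t in (0 : ℝ)..1 / ‖z‖, k t :=
      intervalIntegral.integral_nonneg_of_ae_restrict (by positivity) (by
        rw [EventuallyLE, ae_restrict_iff' measurableSet_Icc]
        filter_upwards [Measure.ae_ne volume 0] with t ht0 ht
        exact hknn t (lt_of_le_of_ne ht.1 (Ne.symm ht0)))
    have := Real.cos_le_one 1
    have := le_abs_self (laplaceTransform b z).re
    nlinarith
  · have hω : 0 < |z.im| := abs_pos.2 h0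
    have h2 := cos_one_mul_integral_le_of_pos hknn (hb.antitoneOn_exp_mul hz.le)
      (hb.convexOn_exp_mul hz.le) hkint hω
    have h3 : ∫ t in (0 : ℝ)..1 / ‖z‖, k t ≤ ∫ t in (0 : ℝ)..1 / |z.im|, k t := by
      refine intervalIntegral.integral_mono_interval le_rfl (by positivity)
        (one_div_le_one_div_of_le hω (Complex.abs_im_le_norm z)) ?_
        (intervalIntegrable_of_integrableOn_Ioi hkint le_rfl (by positivity))
      exact (ae_restrict_iff' measurableSet_Ioc).2 (Eventually.of_forall fun t ht => hknn t ht.1)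
    have e1 : ∫ t in Ioi (0 : ℝ), k t * Real.cos (|z.im| * t) = (laplaceTransform b z).re := by
      rw [hre]
      refine setIntegral_congr_fun measurableSet_Ioi fun t ht => ?_
      rcases abs_choice z.im with h | h <;> simp [h, hk]
    have e2 : ∫ t in Ioi (0 : ℝ), k t * Real.sin (|z.im| * t) ≤ |(laplaceTransform b z).im| := by
      rw [him, abs_neg]
      rcases abs_choice z.im with h | h
      · rw [h]; exact le_abs_self _
      · rw [h]
        simp only [neg_mul, Real.sin_neg, mul_neg, integral_neg]
        exact neg_le_abs _
    have := mul_le_mul_of_nonneg_left h3 hcos.le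
    have := le_abs_self (laplaceTransform b z).re
    linarith

/-- The Laplace transform at a positive real point, as a real number. -/
lemma laplaceTransform_ofReal (b : ℝ → ℝ) (r : ℝ) :
    laplaceTransform b r = ((∫ t in Ioi (0 : ℝ), Real.exp (-(r * t)) * b t : ℝ) : ℂ) := by
  rw [laplaceTransform, ← integral_complex_ofReal]
  refine integral_congr_ae (Eventually.of_forall fun t => ?_)
  push_cast
  simp

lemma Assumption1.laplace_le_integral (hb : Assumption1 b b' ρ) {r : ℝ} (hr : 0 < r) :
    ∫ t in Ioi (0 : ℝ), Real.exp (-(r * t)) * b t ≤ 2 * ∫ t in (0 : ℝ)..1 / r, b t := by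
  have hr' : 0 < 1 / r := by positivity
  have hint := hb.integrableOn_exp_mul hr
  have hbint : IntervalIntegrable b volume 0 (1 / r) := by
    rw [intervalIntegrable_iff_integrableOn_Ioc_of_le hr'.le]
    exact hb.locInt _ hr'
  have hsplit := intervalIntegral.integral_Ioi_sub_Ioi hint hr'.le
  have h1 : ∫ t in (0 : ℝ)..1 / r, Real.exp (-(r * t)) * b t ≤ ∫ t in (0 : ℝ)..1 / r, b t := by
    refine intervalIntegral.integral_mono_on_of_le_Ioo hr'.le
      (intervalIntegrable_of_integrableOn_Ioi hint le_rfl hr'.le) hbint fun t ht => ?_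
    exact mul_le_of_le_one_left (hb.nonneg t ht.1)
      (Real.exp_le_one_iff.2 (by have := mul_pos hr ht.1; linarith))
  have h2 : ∫ t in Ioi (1 / r), Real.exp (-(r * t)) * b t ≤
      ∫ t in Ioi (1 / r), Real.exp (-r * t) * b (1 / r) := by
    refine setIntegral_mono_on (hint.mono_set (Ioi_subset_Ioi hr'.le))
      ((exp_neg_integrableOn_Ioi _ hr).mul_const _) measurableSet_Ioi fun t ht => ?_
    have ht' : 1 / r < t := ht
    rw [neg_mul]
    exact mul_le_mul_of_nonneg_left (hb.anti hr' (hr'.trans ht') ht'.le) (Real.exp_pos _).le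
  have h3 : ∫ t in Ioi (1 / r), Real.exp (-r * t) * b (1 / r) ≤ 1 / r * b (1 / r) := by
    rw [integral_mul_const, integral_exp_mul_Ioi (by linarith : -r < 0)]
    refine mul_le_mul_of_nonneg_right ?_ (hb.nonneg _ hr')
    rw [neg_div_neg_eq]
    refine div_le_div_of_nonneg_right (Real.exp_le_one_iff.2 ?_) hr.le
    have : r * (1 / r) = 1 := by field_simp
    linarith
  have h4 : 1 / r * b (1 / r) ≤ ∫ t in (0 : ℝ)..1 / r, b t := by
    have : ∫ _ in (0 : ℝ)..1 / r, b (1 / r) = 1 / r * b (1 / r) := by simp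
    rw [← this]
    exact intervalIntegral.integral_mono_on_of_le_Ioo hr'.le (by simp) hbint
      fun t ht => hb.anti ht.1 hr' ht.2.le
  linarith

/-- Up to a constant, the modulus of the Laplace transform at `z` is bounded below by its value
at `‖z‖`. -/
lemma Assumption1.laplace_norm_le (hb : Assumption1 b b' ρ) {z : ℂ} (hz : 0 < z.re) :
    Real.cos 1 * Real.exp (-1) / 10 * ∫ t in Ioi (0 : ℝ), Real.exp (-(‖z‖ * t)) * b t ≤
      ‖laplaceTransform b z‖ := by
  have hz0 : 0 < ‖z‖ := norm_pos_iff.2 fun h => by simp [h] at hz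
  have h1 := hb.integral_le_norm_laplace hz
  have h2 := mul_le_mul_of_nonneg_left (hb.laplace_le_integral hz0)
    (by have := Real.cos_one_pos; positivity : 0 ≤ Real.cos 1 * Real.exp (-1) / 10)
  linarith

lemma Assumption1.laplace_real_pos (hb : Assumption1 b b' ρ) {r : ℝ} (hr : 0 < r) :
    0 < ∫ t in Ioi (0 : ℝ), Real.exp (-(r * t)) * b t := by
  obtain ⟨t₀, ht₀, hne⟩ := hb.ne_zero
  have hpos : 0 < b t₀ := lt_of_le_of_ne (hb.nonneg _ ht₀) hne.symm
  have hint := hb.integrableOn_exp_mul hr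
  have h1 : 0 < ∫ t in (0 : ℝ)..t₀, Real.exp (-(r * t)) * b t :=
    intervalIntegral.intervalIntegral_pos_of_pos_on
      (intervalIntegrable_of_integrableOn_Ioi hint le_rfl ht₀.le)
      (fun t ht => mul_pos (Real.exp_pos _) (hpos.trans_le (hb.anti ht.1 ht₀ ht.2.le))) ht₀
  rw [intervalIntegral.integral_of_le ht₀.le] at h1
  refine h1.trans_le (setIntegral_mono_set hint ?_ (Eventually.of_forall fun t ht => ht.1))
  exact (ae_restrict_iff' measurableSet_Ioi).2
    (Eventually.of_forall fun t ht => mul_nonneg (Real.exp_pos _).le (hb.nonneg t ht))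

lemma Assumption1.laplace_real_antitone (hb : Assumption1 b b' ρ) {r q : ℝ} (hr : 0 < r)
    (hrq : r ≤ q) : ∫ t in Ioi (0 : ℝ), Real.exp (-(q * t)) * b t ≤
      ∫ t in Ioi (0 : ℝ), Real.exp (-(r * t)) * b t :=
  setIntegral_mono_on (hb.integrableOn_exp_mul (hr.trans_le hrq)) (hb.integrableOn_exp_mul hr)
    measurableSet_Ioi fun t ht => mul_le_mul_of_nonneg_right
      (Real.exp_le_exp.2 (by have := mul_le_mul_of_nonneg_right hrq (le_of_lt ht); linarith))
      (hb.nonneg t ht)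

lemma Assumption1.laplace_ne_zero (hb : Assumption1 b b' ρ) {z : ℂ} (hz : 0 < z.re) :
    laplaceTransform b z ≠ 0 := by
  have hz0 : 0 < ‖z‖ := norm_pos_iff.2 fun h => by simp [h] at hz
  have h1 := hb.laplace_norm_le hz
  have h2 := hb.laplace_real_pos hz0
  have h3 := Real.cos_one_pos
  exact norm_pos_iff.1 (lt_of_lt_of_le (by positivity) h1)

end Kernel

section Sector

variable {b b' : ℝ → ℝ} {ρ θ : ℝ}

lemma Assumption1.abs_arg_le (hb : Assumption1 b b' ρ) {z : ℂ} (hz : 0 < z.re) :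
    |(laplaceTransform b z).arg| ≤ (ρ - 1) * (Real.pi / 2) := by
  have hpi := Real.pi_pos
  have h : |(laplaceTransform b z).arg| ≤
      sSup {θ : ℝ | ∃ z : ℂ, 0 < z.re ∧ θ = |(laplaceTransform b z).arg|} := by
    refine le_csSup ⟨Real.pi, ?_⟩ ⟨z, hz, rfl⟩
    rintro _ ⟨w, _, rfl⟩
    exact Complex.abs_arg_le_pi _
  have h2 := hb.rho_eq
  have h3 : (ρ - 1) * (Real.pi / 2) =
      sSup {θ : ℝ | ∃ z : ℂ, 0 < z.re ∧ θ = |(laplaceTransform b z).arg|} := by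
    conv_lhs => rw [h2]
    field_simp
    ring
  rwa [h3]

lemma Assumption1.cos_angle_pos (hb : Assumption1 b b' ρ) :
    0 < Real.cos ((ρ - 1) * (Real.pi / 2)) := by
  have hpi := Real.pi_pos
  obtain ⟨h1, h2⟩ := hb.rho_mem
  refine Real.cos_pos_of_mem_Ioo ⟨?_, ?_⟩ <;> nlinarith

lemma Assumption1.cos_mul_norm_le_re (hb : Assumption1 b b' ρ) {z : ℂ} (hz : 0 < z.re) :
    Real.cos ((ρ - 1) * (Real.pi / 2)) * ‖laplaceTransform b z‖ ≤ (laplaceTransform b z).re := by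
  have hpi := Real.pi_pos
  obtain ⟨h1, h2⟩ := hb.rho_mem
  rw [← Complex.norm_mul_cos_arg (laplaceTransform b z), mul_comm, ← Real.cos_abs (Complex.arg _)]
  refine mul_le_mul_of_nonneg_left ?_ (norm_nonneg _)
  exact Real.cos_le_cos_of_nonneg_of_le_pi (abs_nonneg _) (by nlinarith) (hb.abs_arg_le hz)

lemma Assumption1.le_norm_add_mul (hb : Assumption1 b b' ρ) {z : ℂ} (hz : 0 < z.re) {l : ℝ}
    (hl : 0 ≤ l) : Real.cos ((ρ - 1) * (Real.pi / 2)) * (‖z‖ + l * ‖laplaceTransform b z‖) ≤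
      3 * ‖z + l * laplaceTransform b z‖ := by
  set c := Real.cos ((ρ - 1) * (Real.pi / 2))
  have hc := hb.cos_angle_pos
  have hc1 : c ≤ 1 := Real.cos_le_one _
  have h1 : l * (c * ‖laplaceTransform b z‖) ≤ ‖z + l * laplaceTransform b z‖ := by
    refine le_trans ?_ (Complex.re_le_norm _)
    have := mul_le_mul_of_nonneg_left (hb.cos_mul_norm_le_re hz) hl
    simp only [Complex.add_re, Complex.re_ofReal_mul]
    linarith
  have h2 : ‖z‖ ≤ ‖z + l * laplaceTransform b z‖ + l * ‖laplaceTransform b z‖ := by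
    have := norm_sub_le (z + l * laplaceTransform b z) (l * laplaceTransform b z)
    rw [add_sub_cancel_right, norm_mul, Complex.norm_real, Real.norm_of_nonneg hl] at this
    exact this
  have h3 := mul_le_mul_of_nonneg_left h2 (show 0 ≤ c from hc.le)
  nlinarith [norm_nonneg (z + l * laplaceTransform b z)]

lemma abs_arg_lt_of_re_pos (h2 : Assumption2 b ρ θ) {z : ℂ} (hz : 0 < z.re) : |z.arg| < θ :=
  (Complex.abs_arg_lt_pi_div_two_iff.2 (Or.inl hz)).trans h2.theta_gt

lemma Assumption2.differentiableAt_laplace (h2 : Assumption2 b ρ θ) {z : ℂ} (hz : 0 < z.re) :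
    DifferentiableAt ℂ (laplaceTransform b) z := by
  obtain ⟨B, hB, hBL, -⟩ := h2.holo
  refine (hB z (fun h => by simp [h] at hz) (abs_arg_lt_of_re_pos h2 hz)).congr_of_eventuallyEq ?_
  filter_upwards [(isOpen_lt continuous_const Complex.continuous_re).mem_nhds hz] with w hw
  exact (hBL w hw).symm

lemma Assumption2.exists_deriv_le (h2 : Assumption2 b ρ θ) :
    ∃ C > 0, ∀ z : ℂ, 0 < z.re → ‖deriv (laplaceTransform b) z‖ ≤ C * ‖z‖ ^ (-ρ) := by
  obtain ⟨B, hB, hBL, C, hC, -, hd⟩ := h2.holo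
  refine ⟨C, hC, fun z hz => ?_⟩
  have h := hd z (fun h => by simp [h] at hz) (abs_arg_lt_of_re_pos h2 hz)
  have he : B =ᶠ[nhds z] laplaceTransform b := by
    filter_upwards [(isOpen_lt continuous_const Complex.continuous_re).mem_nhds hz] with w hw
    exact hBL w hw
  rwa [he.deriv_eq] at h

/-- Harnack-type lower bound: a holomorphic function on the right half plane with nonnegative real
part which is positive on the real axis decays at most like `1 / x`. -/
lemma le_mul_of_re_nonneg {h : ℂ → ℂ} {g : ℝ → ℝ}
    (hd : ∀ z : ℂ, 0 < z.re → DifferentiableAt ℂ h z) (hre : ∀ z : ℂ, 0 < z.re → 0 ≤ (h z).re)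
    (hg : ∀ x : ℝ, 0 < x → h x = g x) (hpos : ∀ x : ℝ, 0 < x → 0 < g x) {x : ℝ} (hx : 1 ≤ x) :
    g 1 ≤ x * g x := by
  have hg1 := hpos 1 one_pos
  have hh1 : h 1 = g 1 := by simpa using hg 1 one_pos
  have hmob : ∀ ζ : ℂ, ‖ζ‖ < 1 → 0 < ((1 + ζ) / (1 - ζ)).re := fun ζ hζ => by
    have hne : (1 - ζ) ≠ 0 := fun h => by
      rw [sub_eq_zero] at h
      simp [← h] at hζ
    have h1 : ζ.re ^ 2 + ζ.im ^ 2 < 1 := by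
      have := Complex.sq_norm ζ
      rw [Complex.normSq_apply] at this
      nlinarith [norm_nonneg ζ]
    rw [Complex.div_re, ← add_div]
    refine div_pos ?_ (Complex.normSq_pos.2 hne)
    simp
    nlinarith
  have hden : ∀ z : ℂ, 0 < z.re → h z + g 1 ≠ 0 := fun z hz h0 => by
    have := hre z hz
    have h1 := congrArg Complex.re h0
    simp at h1
    linarith
  set F : ℂ → ℂ := fun ζ => (h ((1 + ζ) / (1 - ζ)) - g 1) / (h ((1 + ζ) / (1 - ζ)) + g 1) with hF
  have hFd : DifferentiableOn ℂ F (Metric.ball 0 1) := fun ζ hζ => by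
    have hζ' : ‖ζ‖ < 1 := by simpa using hζ
    have hne : (1 - ζ) ≠ 0 := fun h => by
      rw [sub_eq_zero] at h
      simp [← h] at hζ'
    have h1 : DifferentiableAt ℂ (fun ζ : ℂ => h ((1 + ζ) / (1 - ζ))) ζ :=
      DifferentiableAt.comp ζ (hd _ (hmob ζ hζ'))
        (((differentiableAt_const _).add differentiableAt_id).div
          ((differentiableAt_const _).sub differentiableAt_id) hne)
    exact ((h1.sub_const _).div (h1.add_const _) (hden _ (hmob ζ hζ'))).differentiableWithinAt
  have hFm : MapsTo F (Metric.ball 0 1) (Metric.closedBall 0 1) := fun ζ hζ => by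
    have hζ' : ‖ζ‖ < 1 := by simpa using hζ
    have hw := hmob ζ hζ'
    simp only [hF, mem_closedBall_zero_iff, norm_div]
    rw [div_le_one (norm_pos_iff.2 (hden _ hw))]
    rw [← sq_le_sq₀ (norm_nonneg _) (norm_nonneg _), Complex.sq_norm, Complex.sq_norm,
      Complex.normSq_apply, Complex.normSq_apply]
    have := hre _ hw
    simp only [Complex.sub_re, Complex.add_re, Complex.sub_im, Complex.add_im, Complex.ofReal_re,
      Complex.ofReal_im]
    nlinarith
  have hF0 : F 0 = 0 := by simp [hF, hh1]
  have hx0 : 0 < x := by linarith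
  have hq : 0 ≤ (x - 1) / (x + 1) := div_nonneg (by linarith) (by linarith)
  have hq1 : (x - 1) / (x + 1) < 1 := by rw [div_lt_one (by linarith)]; linarith
  have hnq : ‖(((x - 1) / (x + 1) : ℝ) : ℂ)‖ = (x - 1) / (x + 1) := by
    rw [Complex.norm_real, Real.norm_of_nonneg hq]
  have key := Complex.norm_le_norm_of_mapsTo_ball hFd hFm hF0 (z := (((x - 1) / (x + 1) : ℝ) : ℂ))
    (by rw [hnq]; exact hq1)
  have harg : (1 + (((x - 1) / (x + 1) : ℝ) : ℂ)) / (1 - (((x - 1) / (x + 1) : ℝ) : ℂ)) = x := by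
    have : (1 + (x - 1) / (x + 1)) / (1 - (x - 1) / (x + 1)) = x := by
      have h3 : x + 1 ≠ 0 := by linarith
      field_simp
      ring
    exact_mod_cast congrArg (fun r : ℝ => (r : ℂ)) this
  have hgx := hpos x hx0
  rw [hnq, hF] at key
  simp only [harg, hg x hx0] at key
  rw [← Complex.ofReal_sub, ← Complex.ofReal_add, ← Complex.ofReal_div, Complex.norm_real,
    Real.norm_eq_abs] at key
  have k2 := (neg_le_abs _).trans key
  rw [← neg_div, div_le_div_iff₀ (by linarith) (by linarith)] at k2
  nlinarith

lemma Assumption1.exists_laplace_ge (hb : Assumption1 b b' ρ) (h2 : Assumption2 b ρ θ) :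
    ∃ c > 0, (∀ z : ℂ, 0 < z.re → 1 ≤ ‖z‖ → c * ‖z‖ ^ (1 - ρ) ≤ ‖laplaceTransform b z‖) ∧
      ∀ z : ℂ, 0 < z.re → ‖z‖ ≤ 1 → c ≤ ‖laplaceTransform b z‖ := by
  obtain ⟨hρ1, hρ2⟩ := hb.rho_mem
  have hpi := Real.pi_pos
  set β : ℝ → ℝ := fun r => ∫ t in Ioi (0 : ℝ), Real.exp (-(r * t)) * b t with hβ
  have hβpos : ∀ x > 0, 0 < β x := fun x hx => hb.laplace_real_pos hx
  have hcos := Real.cos_one_pos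
  have hk : 0 < ρ - 1 := by linarith
  have hre0 : ∀ z : ℂ, 0 < z.re → 0 < (laplaceTransform b z).re := fun z hz =>
    (mul_pos hb.cos_angle_pos (norm_pos_iff.2 (hb.laplace_ne_zero hz))).trans_le
      (hb.cos_mul_norm_le_re hz)
  have hbig : ∀ x : ℝ, 1 ≤ x → β 1 * x ^ (1 - ρ) ≤ β x := fun x hx => by
    have hx0 : 0 < x := by linarith
    have h := le_mul_of_re_nonneg
      (h := fun z => Complex.exp ((1 / (ρ - 1) : ℝ) * Complex.log (laplaceTransform b z)))
      (g := fun x => β x ^ (1 / (ρ - 1))) ?_ ?_ ?_ (fun x hx => Real.rpow_pos_of_pos (hβpos x hx) _)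
      hx
    · have h3 := Real.rpow_le_rpow (Real.rpow_nonneg (hβpos 1 one_pos).le _) h hk.le
      rw [Real.mul_rpow hx0.le (Real.rpow_nonneg (hβpos x hx0).le _),
        ← Real.rpow_mul (hβpos 1 one_pos).le, ← Real.rpow_mul (hβpos x hx0).le,
        one_div_mul_cancel hk.ne', Real.rpow_one, Real.rpow_one] at h3
      have h4 : 0 < x ^ (1 - ρ) := Real.rpow_pos_of_pos hx0 _
      have h5 : x ^ (ρ - 1) * x ^ (1 - ρ) = 1 := by
        rw [← Real.rpow_add hx0]; simp
      calc β 1 * x ^ (1 - ρ) ≤ x ^ (ρ - 1) * β x * x ^ (1 - ρ) :=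
            mul_le_mul_of_nonneg_right h3 h4.le
        _ = x ^ (ρ - 1) * x ^ (1 - ρ) * β x := by ring
        _ = β x := by rw [h5, one_mul]
    · intro z hz
      exact (((h2.differentiableAt_laplace hz).clog
        (Complex.mem_slitPlane_iff.2 (Or.inl (hre0 z hz)))).const_mul _).cexp
    · intro z hz
      rw [Complex.exp_re]
      refine mul_nonneg (Real.exp_pos _).le (Real.cos_nonneg_of_mem_Icc ?_)
      rw [Complex.im_ofReal_mul, Complex.log_im]
      have := abs_le.1 (hb.abs_arg_le hz)
      have e : 1 / (ρ - 1) * ((ρ - 1) * (Real.pi / 2)) = Real.pi / 2 := by field_simp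
      have hk' : 0 ≤ 1 / (ρ - 1) := by positivity
      constructor
      · have := mul_le_mul_of_nonneg_left this.1 hk'
        linarith
      · have := mul_le_mul_of_nonneg_left this.2 hk'
        linarith
    · intro x hx
      rw [laplaceTransform_ofReal, ← Complex.ofReal_log (hβpos x hx).le, ← Complex.ofReal_mul,
        ← Complex.ofReal_exp, mul_comm, ← Real.rpow_def_of_pos (hβpos x hx)]
  refine ⟨Real.cos 1 * Real.exp (-1) / 10 * β 1, by have := hβpos 1 one_pos; positivity, ?_, ?_⟩
  · intro z hz h1
    refine le_trans ?_ (hb.laplace_norm_le hz)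
    rw [mul_assoc]
    exact mul_le_mul_of_nonneg_left (hbig _ h1) (by positivity)
  · intro z hz h1
    refine le_trans ?_ (hb.laplace_norm_le hz)
    have hz0 : 0 < ‖z‖ := norm_pos_iff.2 fun h => by simp [h] at hz
    exact mul_le_mul_of_nonneg_left (hb.laplace_real_antitone hz0 h1) (by positivity)

end Sector

/-- The Laplace transform of `t ↦ t * s t`, where `s` is the solution of the scalar Volterra
equation with parameter `l`. -/
def momentSymbol (b : ℝ → ℝ) (l : ℝ) (z : ℂ) : ℂ :=
  (1 + l * deriv (laplaceTransform b) z) / (z + l * laplaceTransform b z) ^ 2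

section Symbol

variable {b b' : ℝ → ℝ} {ρ θ : ℝ}

lemma rpow_interpolation_le {r q S η : ℝ} (hr : 0 ≤ r) (hq : 0 ≤ q) (hrS : r ≤ S) (hqS : q ≤ S)
    (hS : 0 < S) (h0 : 0 ≤ η) (h1 : η ≤ 1) : r ^ (1 - η) * q ^ η ≤ S := by
  calc r ^ (1 - η) * q ^ η ≤ S ^ (1 - η) * S ^ η :=
        mul_le_mul (Real.rpow_le_rpow hr hrS (by linarith)) (Real.rpow_le_rpow hq hqS h0)
          (Real.rpow_nonneg hq _) (Real.rpow_nonneg hS.le _)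
    _ = S := by rw [← Real.rpow_add hS]; simp

lemma Assumption1.exists_momentSymbol_le (hb : Assumption1 b b' ρ) (h2 : Assumption2 b ρ θ)
    {l₀ η : ℝ} (hl₀ : 0 < l₀) (h0 : 0 ≤ η) (h1 : η ≤ 1) :
    ∃ C > 0, ∀ l : ℝ, l₀ ≤ l → ∀ z : ℂ, 0 < z.re →
      ‖momentSymbol b l z‖ ≤ C * l ^ (-η) * (‖z‖ ^ (ρ * η - 2) + ‖z‖ ^ (-2 : ℝ)) := by
  obtain ⟨hρ1, hρ2⟩ := hb.rho_mem
  obtain ⟨C, hC, hderiv⟩ := h2.exists_deriv_le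
  obtain ⟨c₁, hc₁, hlarge, hsmall⟩ := hb.exists_laplace_ge h2
  set c := Real.cos ((ρ - 1) * (Real.pi / 2))
  have hc : 0 < c := hb.cos_angle_pos
  set A : ℝ := 9 * (1 + C / c₁) / c ^ 2 * c₁ ^ (-η) with hA
  set A' : ℝ := 9 * (1 / l₀ + C) / (c ^ 2 * c₁ ^ 2) * l₀ ^ (η - 1) with hA'
  have hApos : 0 < A := by positivity
  have hA'pos : 0 < A' := by positivity
  refine ⟨A + A', by positivity, fun l hl z hz => ?_⟩
  have hl' : 0 < l := hl₀.trans_le hl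
  have hr : 0 < ‖z‖ := norm_pos_iff.2 fun h => by simp [h] at hz
  have hL : 0 < ‖laplaceTransform b z‖ := norm_pos_iff.2 (hb.laplace_ne_zero hz)
  set r := ‖z‖ with hrdef
  set S := r + l * ‖laplaceTransform b z‖ with hS
  have hSpos : 0 < S := by positivity
  have hden : c / 3 * S ≤ ‖z + l * laplaceTransform b z‖ := by
    have := hb.le_norm_add_mul hz hl'.le
    change c * S ≤ _ at this
    linarith
  have hnum : ‖1 + l * deriv (laplaceTransform b) z‖ ≤ 1 + l * (C * r ^ (-ρ)) := by
    refine (norm_add_le _ _).trans ?_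
    rw [norm_mul, norm_one, Complex.norm_real, Real.norm_of_nonneg hl'.le]
    have := mul_le_mul_of_nonneg_left (hderiv z hz) hl'.le
    linarith
  have hmain : ∀ X : ℝ, 1 + l * (C * r ^ (-ρ)) ≤ X →
      ‖momentSymbol b l z‖ ≤ X / (c / 3 * S) ^ 2 := fun X hX => by
    rw [momentSymbol, norm_div, norm_pow]
    exact div_le_div₀ ((norm_nonneg _).trans (hnum.trans hX)) (hnum.trans hX) (by positivity) (pow_le_pow_left₀ (by positivity) hden 2)
  have hx1 : 0 < r ^ (ρ * η - 2) := Real.rpow_pos_of_pos hr _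
  have hx2 : 0 < r ^ (-2 : ℝ) := Real.rpow_pos_of_pos hr _
  have hx3 : 0 < l ^ (-η) := Real.rpow_pos_of_pos hl' _
  rcases le_total 1 r with h | h
  · have hlow := hlarge z hz h
    rw [← hrdef] at hlow
    have hX : 1 + l * (C * r ^ (-ρ)) ≤ (1 + C / c₁) * S / r := by
      have e1 : r ^ (-ρ) = r ^ (1 - ρ) / r := by
        rw [← Real.rpow_sub_one hr.ne']; congr 1; ring
      have e2 : l * (C * r ^ (-ρ)) ≤ C / c₁ * (l * ‖laplaceTransform b z‖) / r := by
        rw [e1]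
        have : C / c₁ * (l * (c₁ * r ^ (1 - ρ))) / r = l * (C * (r ^ (1 - ρ) / r)) := by
          field_simp
        rw [← this]
        gcongr
      have e3 : (1 + C / c₁) * S / r = 1 + C / c₁ + (l * ‖laplaceTransform b z‖) / r +
          C / c₁ * (l * ‖laplaceTransform b z‖) / r := by
        rw [hS]; field_simp; ring
      rw [e3]
      have : 0 ≤ C / c₁ := by positivity
      have : 0 ≤ (l * ‖laplaceTransform b z‖) / r := by positivity
      linarith
    have hSlow : r ^ (1 - η) * (l * (c₁ * r ^ (1 - ρ))) ^ η ≤ S := by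
      refine rpow_interpolation_le hr.le (by positivity) ?_ ?_ hSpos h0 h1
      · rw [hS]; have := mul_pos hl' hL; linarith
      · rw [hS]; have := mul_le_mul_of_nonneg_left hlow hl'.le; linarith
    have e4 : r ^ (1 - η) * (l * (c₁ * r ^ (1 - ρ))) ^ η = l ^ η * c₁ ^ η * r ^ (1 - ρ * η) := by
      rw [Real.mul_rpow hl'.le (by positivity), Real.mul_rpow hc₁.le (by positivity),
        ← Real.rpow_mul hr.le]
      have : r ^ (1 - ρ * η) = r ^ (1 - η) * r ^ ((1 - ρ) * η) := by
        rw [← Real.rpow_add hr]; congr 1; ring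
      rw [this]; ring
    rw [e4] at hSlow
    calc ‖momentSymbol b l z‖ ≤ (1 + C / c₁) * S / r / (c / 3 * S) ^ 2 := hmain _ hX
      _ = 9 * (1 + C / c₁) / c ^ 2 * (1 / (r * S)) := by field_simp; norm_num
      _ ≤ 9 * (1 + C / c₁) / c ^ 2 * (1 / (r * (l ^ η * c₁ ^ η * r ^ (1 - ρ * η)))) := by
          gcongr
      _ = A * l ^ (-η) * r ^ (ρ * η - 2) := by
          have : r ^ (ρ * η - 2) = 1 / (r * r ^ (1 - ρ * η)) := by
            rw [eq_div_iff (by positivity), mul_comm r, ← mul_assoc, ← Real.rpow_add hr,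
              ← Real.rpow_add_one hr.ne']
            ring_nf
            simp
          rw [this, hA, Real.rpow_neg hl'.le, Real.rpow_neg hc₁.le]
          field_simp
      _ ≤ (A + A') * l ^ (-η) * (r ^ (ρ * η - 2) + r ^ (-2 : ℝ)) := by
          gcongr <;> linarith
  · have hlow := hsmall z hz h
    have hr2 : r ^ (-ρ) ≤ r ^ (-2 : ℝ) := Real.rpow_le_rpow_of_exponent_ge hr h (by linarith)
    have hr1 : 1 ≤ r ^ (-2 : ℝ) := Real.one_le_rpow_of_pos_of_le_one_of_nonpos hr h (by norm_num)
    have hX : 1 + l * (C * r ^ (-ρ)) ≤ (1 / l₀ + C) * l * r ^ (-2 : ℝ) := by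
      have e1 : 1 ≤ 1 / l₀ * l * r ^ (-2 : ℝ) := by
        have : 1 ≤ 1 / l₀ * l := by rw [one_div_mul_eq_div, le_div_iff₀ hl₀]; linarith
        nlinarith
      have e2 : l * (C * r ^ (-ρ)) ≤ C * l * r ^ (-2 : ℝ) := by
        rw [mul_left_comm, mul_assoc]; gcongr
      linarith
    have hSlow : l * c₁ ≤ S := by
      rw [hS]; have := mul_le_mul_of_nonneg_left hlow hl'.le; linarith
    calc ‖momentSymbol b l z‖ ≤ (1 / l₀ + C) * l * r ^ (-2 : ℝ) / (c / 3 * S) ^ 2 := hmain _ hX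
      _ ≤ (1 / l₀ + C) * l * r ^ (-2 : ℝ) / (c / 3 * (l * c₁)) ^ 2 := by gcongr
      _ = 9 * (1 / l₀ + C) / (c ^ 2 * c₁ ^ 2) * l ^ (-1 : ℝ) * r ^ (-2 : ℝ) := by
          rw [Real.rpow_neg_one]; field_simp; ring
      _ ≤ 9 * (1 / l₀ + C) / (c ^ 2 * c₁ ^ 2) * (l₀ ^ (η - 1) * l ^ (-η)) * r ^ (-2 : ℝ) := by
          gcongr
          have : l ^ (-1 : ℝ) = l ^ (η - 1) * l ^ (-η) := by
            rw [← Real.rpow_add hl']; congr 1; ring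
          rw [this]
          gcongr ?_ * _
          exact Real.rpow_le_rpow_of_nonpos hl₀ hl (by linarith)
      _ = A' * l ^ (-η) * r ^ (-2 : ℝ) := by rw [hA']; ring
      _ ≤ (A + A') * l ^ (-η) * (r ^ (ρ * η - 2) + r ^ (-2 : ℝ)) := by
          gcongr <;> linarith

lemma Assumption1.add_mul_laplace_ne_zero (hb : Assumption1 b b' ρ) {z : ℂ} (hz : 0 < z.re)
    {l : ℝ} (hl : 0 ≤ l) : z + l * laplaceTransform b z ≠ 0 := by
  intro h
  have h1 := hb.le_norm_add_mul hz hl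
  have hr : 0 < ‖z‖ := norm_pos_iff.2 fun h => by simp [h] at hz
  rw [h, norm_zero, mul_zero] at h1
  have := mul_pos hb.cos_angle_pos
    (add_pos_of_pos_of_nonneg hr (mul_nonneg hl (norm_nonneg (laplaceTransform b z))))
  linarith

lemma differentiableAt_momentSymbol (hb : Assumption1 b b' ρ) (h2 : Assumption2 b ρ θ) {z : ℂ}
    (hz : 0 < z.re) {l : ℝ} (hl : 0 ≤ l) : DifferentiableAt ℂ (momentSymbol b l) z := by
  have hd : DifferentiableAt ℂ (deriv (laplaceTransform b)) z := by
    have hopen : IsOpen {w : ℂ | 0 < w.re} := isOpen_lt continuous_const Complex.continuous_re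
    have h : DifferentiableOn ℂ (laplaceTransform b) {w : ℂ | 0 < w.re} :=
      fun w hw => (h2.differentiableAt_laplace hw).differentiableWithinAt
    exact (h.deriv hopen).differentiableAt (hopen.mem_nhds hz)
  exact ((hd.const_mul _).const_add _).div
    ((differentiableAt_id.add ((h2.differentiableAt_laplace hz).const_mul _)).pow 2)
    (pow_ne_zero 2 (hb.add_mul_laplace_ne_zero hz hl))

end Symbol

section Volterra

variable {b b' : ℝ → ℝ} {ρ θ l : ℝ} {s s' : ℝ → ℝ}

lemma Assumption1.exists_exponent (hb : Assumption1 b b' ρ) (hl : 0 < l) :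
    ∃ M > 0, l * ∫ t in Ioi (0 : ℝ), Real.exp (-(M * t)) * b t ≤ M / 2 := by
  have h := hb.laplace_real_antitone one_pos (le_max_left 1
    (2 * (l * ∫ t in Ioi (0 : ℝ), Real.exp (-(1 * t)) * b t)))
  refine ⟨_, lt_of_lt_of_le one_pos (le_max_left _ _), (mul_le_mul_of_nonneg_left h hl.le).trans ?_⟩
  have := le_max_right 1 (2 * (l * ∫ t in Ioi (0 : ℝ), Real.exp (-(1 * t)) * b t))
  linarith

lemma IsScalarSolution.abs_deriv_le (hs : IsScalarSolution b l s s') (hb : Assumption1 b b' ρ)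
    (hl : 0 < l) {M m : ℝ} (hM : 0 < M)
    (hM2 : l * ∫ t in Ioi (0 : ℝ), Real.exp (-(M * t)) * b t ≤ M / 2) (hm : 0 ≤ m) {t : ℝ}
    (ht : 0 < t) (hbd : ∀ u ∈ Icc 0 t, |s u| ≤ m * Real.exp (M * u)) :
    |s' t| ≤ m / 2 * (M * Real.exp (M * t)) := by
  have hexp := hb.integrableOn_exp_mul hM
  have hint : IntervalIntegrable (fun v => m * Real.exp (M * t) * (Real.exp (-(M * v)) * b v))
      volume 0 t := (intervalIntegrable_of_integrableOn_Ioi hexp le_rfl ht.le).const_mul _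
  have hint' : IntervalIntegrable
      (fun u => m * Real.exp (M * t) * (Real.exp (-(M * (t - u))) * b (t - u))) volume 0 t := by
    simpa using (hint.comp_sub_left t).symm
  have h1 : |∫ u in (0 : ℝ)..t, b (t - u) * s u| ≤
      ∫ u in (0 : ℝ)..t, m * Real.exp (M * t) * (Real.exp (-(M * (t - u))) * b (t - u)) := by
    rw [← Real.norm_eq_abs]
    refine intervalIntegral.norm_integral_le_of_norm_le ht.le ?_ hint'
    have hne : ∀ᵐ u : ℝ, u ≠ t := by simp [ae_iff]
    filter_upwards [hne] with u hu hmem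
    have hut : 0 < t - u := sub_pos.2 (lt_of_le_of_ne hmem.2 hu)
    have hb0 := hb.nonneg _ hut
    rw [norm_mul, Real.norm_of_nonneg hb0, Real.norm_eq_abs]
    have h2 := mul_le_mul_of_nonneg_left (hbd u ⟨hmem.1.le, hmem.2⟩) hb0
    have h3 : Real.exp (M * t) * Real.exp (-(M * (t - u))) = Real.exp (M * u) := by
      rw [← Real.exp_add]; congr 1; ring
    calc b (t - u) * |s u| ≤ b (t - u) * (m * Real.exp (M * u)) := h2
      _ = m * Real.exp (M * t) * (Real.exp (-(M * (t - u))) * b (t - u)) := by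
        rw [← h3]; ring
  rw [intervalIntegral.integral_comp_sub_left
    (fun v => m * Real.exp (M * t) * (Real.exp (-(M * v)) * b v)), sub_self, sub_zero,
    intervalIntegral.integral_const_mul] at h1
  have h4 : ∫ v in (0 : ℝ)..t, Real.exp (-(M * v)) * b v ≤
      ∫ v in Ioi (0 : ℝ), Real.exp (-(M * v)) * b v := by
    rw [intervalIntegral.integral_of_le ht.le]
    refine setIntegral_mono_set hexp ?_ (Eventually.of_forall fun u hu => hu.1)
    exact (ae_restrict_iff' measurableSet_Ioi).2
      (Eventually.of_forall fun u hu => mul_nonneg (Real.exp_pos _).le (hb.nonneg u hu))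
  have h5 : s' t = -(l * ∫ u in (0 : ℝ)..t, b (t - u) * s u) := by
    have := hs.eqn t ht; linarith
  rw [h5, abs_neg, abs_mul, abs_of_pos hl]
  have h6 : 0 ≤ m * Real.exp (M * t) := by positivity
  calc l * |∫ u in (0 : ℝ)..t, b (t - u) * s u|
      ≤ l * (m * Real.exp (M * t) * ∫ v in Ioi (0 : ℝ), Real.exp (-(M * v)) * b v) :=
        mul_le_mul_of_nonneg_left (h1.trans (mul_le_mul_of_nonneg_left h4 h6)) hl.le
    _ = m * Real.exp (M * t) * (l * ∫ v in Ioi (0 : ℝ), Real.exp (-(M * v)) * b v) := by ring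
    _ ≤ m * Real.exp (M * t) * (M / 2) := mul_le_mul_of_nonneg_left hM2 h6
    _ = m / 2 * (M * Real.exp (M * t)) := by ring

lemma IsScalarSolution.abs_le_exp (hs : IsScalarSolution b l s s') (hb : Assumption1 b b' ρ)
    (hl : 0 < l) {M : ℝ} (hM : 0 < M)
    (hM2 : l * ∫ t in Ioi (0 : ℝ), Real.exp (-(M * t)) * b t ≤ M / 2) {T : ℝ} (hT : 0 ≤ T) :
    |s T| ≤ 2 * Real.exp (M * T) := by
  have hsc : ContinuousOn s (Icc 0 T) := hs.cont.mono Icc_subset_Ici_self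
  obtain ⟨t₀, ht₀, hmax⟩ := isCompact_Icc.exists_isMaxOn (nonempty_Icc.2 hT)
    (f := fun u => |s u| * Real.exp (-(M * u)))
    (hsc.abs.mul (Continuous.continuousOn (by fun_prop)))
  set m := |s t₀| * Real.exp (-(M * t₀)) with hmdef
  have hm : 0 ≤ m := by positivity
  have hbd : ∀ u ∈ Icc 0 T, |s u| ≤ m * Real.exp (M * u) := fun u hu => by
    have h1 : |s u| * Real.exp (-(M * u)) ≤ m := hmax hu
    have h2 := mul_le_mul_of_nonneg_right h1 (Real.exp_pos (M * u)).le
    rwa [mul_assoc, ← Real.exp_add, neg_add_cancel, Real.exp_zero, mul_one] at h2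
  have hd : ∀ t ∈ Ioo 0 T, |s' t| ≤ m / 2 * (M * Real.exp (M * t)) := fun t ht =>
    hs.abs_deriv_le hb hl hM hM2 hm ht.1 fun u hu => hbd u ⟨hu.1, hu.2.trans ht.2.le⟩
  have hE : ∀ t : ℝ, HasDerivAt (fun t => m / 2 * Real.exp (M * t))
      (m / 2 * (M * Real.exp (M * t))) t := fun t => by
    have := (((hasDerivAt_id t).const_mul M).exp).const_mul (m / 2)
    simpa [mul_comm] using this
  have hEc : ContinuousOn (fun t => m / 2 * Real.exp (M * t)) (Icc 0 T) :=
    Continuous.continuousOn (by fun_prop)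
  have hanti : AntitoneOn (fun t => s t - m / 2 * Real.exp (M * t)) (Icc 0 T) := by
    refine antitoneOn_of_deriv_nonpos (convex_Icc 0 T) (hsc.sub hEc) ?_ ?_
    · rw [interior_Icc]
      exact fun t ht => ((hs.hasDeriv t ht.1).sub (hE t)).differentiableAt.differentiableWithinAt
    · rw [interior_Icc]
      intro t ht
      rw [((hs.hasDeriv t ht.1).fun_sub (hE t)).deriv]
      linarith [(abs_le.1 (hd t ht)).2]
  have hmono : MonotoneOn (fun t => s t + m / 2 * Real.exp (M * t)) (Icc 0 T) := by
    refine monotoneOn_of_deriv_nonneg (convex_Icc 0 T) (hsc.add hEc) ?_ ?_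
    · rw [interior_Icc]
      exact fun t ht => ((hs.hasDeriv t ht.1).add (hE t)).differentiableAt.differentiableWithinAt
    · rw [interior_Icc]
      intro t ht
      rw [((hs.hasDeriv t ht.1).fun_add (hE t)).deriv]
      linarith [(abs_le.1 (hd t ht)).1]
  have h0 : (0 : ℝ) ∈ Icc 0 T := ⟨le_rfl, hT⟩
  have hup := hanti h0 ht₀ ht₀.1
  have hlo := hmono h0 ht₀ ht₀.1
  simp only [hs.init, mul_zero, Real.exp_zero, mul_one] at hup hlo
  have habs : |s t₀| ≤ 1 + m / 2 * Real.exp (M * t₀) := by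
    rw [abs_le]; constructor <;> linarith
  have hm2 : m ≤ 2 := by
    have h1 : m ≤ (1 + m / 2 * Real.exp (M * t₀)) * Real.exp (-(M * t₀)) :=
      mul_le_mul_of_nonneg_right habs (Real.exp_pos _).le
    rw [add_mul, mul_assoc, ← Real.exp_add, add_neg_cancel, Real.exp_zero] at h1
    have h2 : Real.exp (-(M * t₀)) ≤ 1 :=
      Real.exp_le_one_iff.2 (by have := mul_nonneg hM.le ht₀.1; linarith)
    linarith
  exact (hbd T ⟨hT, le_rfl⟩).trans (mul_le_mul_of_nonneg_right hm2 (Real.exp_pos _).le)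

lemma integrableOn_cexp_mul_of_abs_le {f : ℝ → ℝ}
    (hf : AEStronglyMeasurable f (volume.restrict (Ioi 0))) {M K : ℝ}
    (hbd : ∀ t > 0, |f t| ≤ K * Real.exp (M * t)) {z : ℂ} (hz : M < z.re) :
    IntegrableOn (fun t : ℝ => Complex.exp (-z * t) * (f t : ℂ)) (Ioi 0) := by
  refine (((exp_neg_integrableOn_Ioi 0 (sub_pos.2 hz)).const_mul K)).mono'
    ((Continuous.aestronglyMeasurable (by fun_prop)).mul
      (Complex.continuous_ofReal.comp_aestronglyMeasurable hf)) ?_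
  filter_upwards [ae_restrict_mem measurableSet_Ioi] with t ht
  have h1 : ‖Complex.exp (-z * t)‖ = Real.exp (-(z.re * t)) := by
    rw [Complex.norm_exp]; simp
  rw [norm_mul, h1, Complex.norm_real, Real.norm_eq_abs]
  calc Real.exp (-(z.re * t)) * |f t| ≤ Real.exp (-(z.re * t)) * (K * Real.exp (M * t)) :=
        mul_le_mul_of_nonneg_left (hbd t ht) (Real.exp_pos _).le
    _ = K * Real.exp (-(z.re - M) * t) := by
        rw [mul_left_comm, ← Real.exp_add]; congr 2; ring

lemma IsScalarSolution.aestronglyMeasurable (hs : IsScalarSolution b l s s') :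
    AEStronglyMeasurable s (volume.restrict (Ioi 0)) :=
  (hs.cont.mono Ioi_subset_Ici_self).aestronglyMeasurable measurableSet_Ioi

lemma IsScalarSolution.laplace_mul_eq_one (hs : IsScalarSolution b l s s')
    (hb : Assumption1 b b' ρ) (hl : 0 < l) {M : ℝ} (hM : 0 < M)
    (hM2 : l * ∫ t in Ioi (0 : ℝ), Real.exp (-(M * t)) * b t ≤ M / 2) {z : ℂ} (hz : M < z.re) :
    laplaceTransform s z * (z + l * laplaceTransform b z) = 1 := by
  have hbd : ∀ t, 0 ≤ t → |s t| ≤ 2 * Real.exp (M * t) := fun t ht => hs.abs_le_exp hb hl hM hM2 ht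
  have hbd' : ∀ t > 0, |s' t| ≤ M * Real.exp (M * t) := fun t ht =>
    (hs.abs_deriv_le hb hl hM hM2 zero_le_two ht fun u hu => hbd u hu.1).trans_eq (by ring)
  have hsm' : AEStronglyMeasurable s' (volume.restrict (Ioi 0)) := by
    refine (measurable_deriv s).aestronglyMeasurable.congr ?_
    filter_upwards [ae_restrict_mem measurableSet_Ioi] with t ht
    exact (hs.hasDeriv t ht).deriv
  have hI := integrableOn_cexp_mul_of_abs_le hs.aestronglyMeasurable (fun t ht => hbd t ht.le) hz
  have hI' := integrableOn_cexp_mul_of_abs_le hsm' hbd' hz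
  have hIb := hb.integrableOn_cexp_mul (hM.trans hz)
  have hexp : ∀ t : ℝ, HasDerivAt (fun t : ℝ => Complex.exp (-z * t))
      (-z * Complex.exp (-z * t)) t := fun t => by
    have := ((hasDerivAt_id (t : ℂ)).const_mul (-z)).cexp.comp_ofReal
    simpa [mul_comm] using this
  have hparts := integral_Ioi_of_hasDerivAt_of_tendsto
    (f := fun t : ℝ => Complex.exp (-z * t) * (s t : ℂ))
    (f' := fun t : ℝ => -z * (Complex.exp (-z * t) * (s t : ℂ)) +
      Complex.exp (-z * t) * (s' t : ℂ)) (a := 0) (m := 0)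
    (((hexp 0).continuousAt.continuousWithinAt).mul
      (Complex.continuous_ofReal.continuousAt.comp_continuousWithinAt (hs.cont 0 self_mem_Ici)))
    (fun t ht => by
      exact ((hexp t).fun_mul (hs.hasDeriv t ht).ofReal_comp).congr_deriv (by ring))
    ((hI.const_mul _).add hI') (by
      have hlim : Tendsto (fun t : ℝ => 2 * Real.exp (-((z.re - M) * t))) atTop (nhds 0) := by
        rw [← mul_zero (2 : ℝ)]
        exact (Real.tendsto_exp_neg_atTop_nhds_zero.comp
          (tendsto_id.const_mul_atTop (sub_pos.2 hz))).const_mul 2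
      refine squeeze_zero_norm' ?_ hlim
      filter_upwards [eventually_ge_atTop 0] with t ht
      have h1 : ‖Complex.exp (-z * t)‖ = Real.exp (-(z.re * t)) := by
        rw [Complex.norm_exp]; simp
      rw [norm_mul, h1, Complex.norm_real, Real.norm_eq_abs]
      calc Real.exp (-(z.re * t)) * |s t| ≤ Real.exp (-(z.re * t)) * (2 * Real.exp (M * t)) :=
            mul_le_mul_of_nonneg_left (hbd t ht) (Real.exp_pos _).le
        _ = 2 * Real.exp (-((z.re - M) * t)) := by
            rw [mul_left_comm, ← Real.exp_add]; congr 2; ring)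
  rw [integral_add (hI.const_mul _) hI', integral_const_mul] at hparts
  have hconv := integral_posConvolution hI hIb (ContinuousLinearMap.mul ℝ ℂ)
  have hs'conv : ∫ t in Ioi (0 : ℝ), Complex.exp (-z * t) * (s' t : ℂ) =
      -l * (laplaceTransform s z * laplaceTransform b z) := by
    rw [ContinuousLinearMap.mul_apply'] at hconv
    rw [laplaceTransform, laplaceTransform, ← hconv, ← integral_const_mul]
    refine setIntegral_congr_fun measurableSet_Ioi fun t ht => ?_
    have h5 : s' t = -l * ∫ u in (0 : ℝ)..t, b (t - u) * s u := by
      have := hs.eqn t ht; linarith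
    rw [h5]
    push_cast
    rw [mul_left_comm, ← intervalIntegral.integral_ofReal,
      ← intervalIntegral.integral_const_mul]
    congr 1
    refine intervalIntegral.integral_congr fun u _ => ?_
    simp only [ContinuousLinearMap.mul_apply']
    have : Complex.exp (-z * t) = Complex.exp (-z * u) * Complex.exp (-z * (t - u)) := by
      rw [← Complex.exp_add]; congr 1; ring
    rw [this]
    push_cast
    ring
  rw [hs'conv] at hparts
  simp only [Complex.ofReal_zero, mul_zero, Complex.exp_zero, hs.init, Complex.ofReal_one,
    one_mul, zero_sub] at hparts
  change -z * laplaceTransform s z + _ = _ at hparts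
  linear_combination -hparts

lemma IsScalarSolution.laplace_moment_eq (hs : IsScalarSolution b l s s')
    (hb : Assumption1 b b' ρ) (h2 : Assumption2 b ρ θ) (hl : 0 < l) {M : ℝ} (hM : 0 < M)
    (hM2 : l * ∫ t in Ioi (0 : ℝ), Real.exp (-(M * t)) * b t ≤ M / 2) {z : ℂ} (hz : M < z.re) :
    laplaceTransform (fun t => t * s t) z = momentSymbol b l z := by
  have hbd : ∀ t, 0 ≤ t → |s t| ≤ 2 * Real.exp (M * t) := fun t ht => hs.abs_le_exp hb hl hM hM2 ht
  have hsm := hs.aestronglyMeasurable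
  have hzpos : 0 < z.re := hM.trans hz
  set ε := (z.re - M) / 2 with hε
  have hε0 : 0 < ε := by rw [hε]; linarith
  have hderiv := hasDerivAt_integral_of_dominated_loc_of_deriv_le
    (F := fun (w : ℂ) (t : ℝ) => Complex.exp (-w * t) * (s t : ℂ))
    (F' := fun (w : ℂ) (t : ℝ) => -(Complex.exp (-w * t) * ((t * s t : ℝ) : ℂ)))
    (μ := volume.restrict (Ioi 0)) (x₀ := z) (s := Metric.ball z ε)
    (bound := fun t : ℝ => 2 * (t ^ (1 : ℝ) * Real.exp (-ε * t ^ (1 : ℝ))))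
    (Metric.ball_mem_nhds z hε0)
    (Eventually.of_forall fun w => (Continuous.aestronglyMeasurable (by fun_prop)).mul
      (Complex.continuous_ofReal.comp_aestronglyMeasurable hsm))
    (integrableOn_cexp_mul_of_abs_le hsm (fun t ht => hbd t ht.le) hz)
    (((Continuous.aestronglyMeasurable (by fun_prop)).mul
      (Complex.continuous_ofReal.comp_aestronglyMeasurable
        (continuous_id.aestronglyMeasurable.mul hsm))).neg)
    (by
      filter_upwards [ae_restrict_mem measurableSet_Ioi] with t ht w hw
      have ht' : 0 < t := ht
      have hre : z.re - w.re < ε := by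
        have h1 := (Complex.re_le_norm (z - w)).trans_lt (mem_ball_iff_norm'.1 hw)
        simpa using h1
      have h1 : ‖Complex.exp (-w * t)‖ = Real.exp (-(w.re * t)) := by
        rw [Complex.norm_exp]; simp
      rw [norm_neg, norm_mul, h1, Complex.norm_real, Real.norm_eq_abs, abs_mul, abs_of_pos ht',
        Real.rpow_one]
      calc Real.exp (-(w.re * t)) * (t * |s t|)
          ≤ Real.exp (-(w.re * t)) * (t * (2 * Real.exp (M * t))) := by
            have := hbd t ht'.le
            gcongr
        _ = 2 * (t * Real.exp (-(w.re * t) + M * t)) := by rw [Real.exp_add]; ring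
        _ ≤ 2 * (t * Real.exp (-ε * t)) := by
            have : -(w.re * t) + M * t ≤ -ε * t := by
              have : (ε + M - w.re) * t ≤ 0 :=
                mul_nonpos_of_nonpos_of_nonneg (by rw [hε] at hre ⊢; linarith) ht'.le
              linarith
            gcongr)
    ((integrableOn_rpow_mul_exp_neg_mul_rpow (by norm_num) one_pos hε0).const_mul 2)
    (Eventually.of_forall fun t w _ => by
      exact ((((hasDerivAt_id' w).fun_neg.mul_const (t : ℂ)).cexp).mul_const (s t : ℂ)).congr_deriv
        (by push_cast; ring))
  have heq : (fun w => ∫ t in Ioi (0 : ℝ), Complex.exp (-w * t) * (s t : ℂ)) =ᶠ[nhds z]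
      fun w => (w + l * laplaceTransform b w)⁻¹ := by
    filter_upwards [(isOpen_lt continuous_const Complex.continuous_re).mem_nhds hz] with w hw
    exact eq_inv_of_mul_eq_one_left (hs.laplace_mul_eq_one hb hl hM hM2 hw)
  have hd2 := ((((hasDerivAt_id z).add ((h2.differentiableAt_laplace hzpos).hasDerivAt.const_mul
    (l : ℂ)))).inv (hb.add_mul_laplace_ne_zero hzpos hl.le)).congr_of_eventuallyEq heq
  have := hderiv.2.unique hd2
  rw [integral_neg, neg_div] at this
  exact neg_inj.1 this

end Volterra

section Inversion

lemma norm_ofReal_add_mul_I_pos {x : ℝ} (hx : 0 < x) (ω : ℝ) : 0 < ‖(x : ℂ) + ω * Complex.I‖ :=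
  norm_pos_iff.2 fun h => by
    have := congrArg Complex.re h
    simp at this
    exact hx.ne' this

lemma norm_ofReal_add_mul_I_eq {x : ℝ} (hx : 0 < x) (ω : ℝ) :
    ‖(x : ℂ) + ω * Complex.I‖ = x * ‖((1 : ℝ) : ℂ) + (ω / x : ℝ) * Complex.I‖ := by
  have hx' : (x : ℂ) ≠ 0 := Complex.ofReal_ne_zero.2 hx.ne'
  have : (x : ℂ) + ω * Complex.I = (x : ℂ) * (((1 : ℝ) : ℂ) + (ω / x : ℝ) * Complex.I) := by
    push_cast; field_simp
  rw [this, norm_mul, Complex.norm_real, Real.norm_of_nonneg hx.le]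

lemma integrable_norm_one_add_mul_I_rpow {p : ℝ} (hp : 1 < p) :
    Integrable fun ω : ℝ => ‖((1 : ℝ) : ℂ) + ω * Complex.I‖ ^ (-p) := by
  refine (integrable_rpow_neg_one_add_norm_sq (E := ℝ) (r := p) (by simpa using hp)).congr
    (Eventually.of_forall fun ω => ?_)
  dsimp only
  rw [Complex.norm_add_mul_I, Real.sqrt_eq_rpow, ← Real.rpow_mul (by positivity), one_pow,
    Real.norm_eq_abs, sq_abs]
  congr 1
  ring

lemma integrable_norm_add_mul_I_rpow {p x : ℝ} (hp : 1 < p) (hx : 0 < x) :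
    Integrable fun ω : ℝ => ‖(x : ℂ) + ω * Complex.I‖ ^ (-p) := by
  refine (((integrable_norm_one_add_mul_I_rpow hp).comp_div hx.ne').const_mul (x ^ (-p))).congr
    (Eventually.of_forall fun ω => ?_)
  dsimp only
  rw [norm_ofReal_add_mul_I_eq hx, Real.mul_rpow hx.le (norm_nonneg _)]

lemma integral_norm_add_mul_I_rpow {p x : ℝ} (hx : 0 < x) :
    ∫ ω : ℝ, ‖(x : ℂ) + ω * Complex.I‖ ^ (-p) =
      x ^ (1 - p) * ∫ ω : ℝ, ‖((1 : ℝ) : ℂ) + ω * Complex.I‖ ^ (-p) := by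
  have h : ∀ ω : ℝ, ‖(x : ℂ) + ω * Complex.I‖ ^ (-p) =
      x ^ (-p) * ‖((1 : ℝ) : ℂ) + (ω / x : ℝ) * Complex.I‖ ^ (-p) := fun ω => by
    rw [norm_ofReal_add_mul_I_eq hx, Real.mul_rpow hx.le (norm_nonneg _)]
  simp_rw [h]
  rw [integral_const_mul, Measure.integral_comp_div
    (fun ω : ℝ => ‖((1 : ℝ) : ℂ) + ω * Complex.I‖ ^ (-p)), abs_of_pos hx, smul_eq_mul, ← mul_assoc,
    ← Real.rpow_add_one hx.ne', neg_add_eq_sub]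

lemma continuous_vertical_line {F : ℂ → ℂ} (hF : ∀ z : ℂ, 0 < z.re → DifferentiableAt ℂ F z)
    {x : ℝ} (hx : 0 < x) : Continuous fun ω : ℝ => F (x + ω * Complex.I) :=
  continuous_iff_continuousAt.2 fun ω =>
    ContinuousAt.comp (f := fun ω : ℝ => (x : ℂ) + ω * Complex.I)
      (hF _ (by simpa using hx)).continuousAt (Continuous.continuousAt (by fun_prop))

lemma integrable_vertical_line {F : ℂ → ℂ} (hF : ∀ z : ℂ, 0 < z.re → DifferentiableAt ℂ F z)
    {x A : ℝ} (hx : 0 < x) (hA : ∀ z : ℂ, z.re = x → ‖F z‖ ≤ A * ‖z‖ ^ (-2 : ℝ)) :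
    Integrable fun ω : ℝ => F (x + ω * Complex.I) :=
  ((integrable_norm_add_mul_I_rpow one_lt_two hx).const_mul A).mono'
    (continuous_vertical_line hF hx).aestronglyMeasurable
    (Eventually.of_forall fun ω => hA _ (by simp))

/-- Vertical line integrals of a holomorphic function decaying quadratically do not depend on the
abscissa. -/
lemma integral_vertical_line_eq {F : ℂ → ℂ} (hF : ∀ z : ℂ, 0 < z.re → DifferentiableAt ℂ F z)
    {x y A : ℝ} (hx : 0 < x) (hxy : x ≤ y)
    (hA : ∀ z : ℂ, z.re ∈ Icc x y → ‖F z‖ ≤ A * ‖z‖ ^ (-2 : ℝ)) :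
    ∫ ω : ℝ, F (x + ω * Complex.I) = ∫ ω : ℝ, F (y + ω * Complex.I) := by
  have hy : 0 < y := hx.trans_le hxy
  have hIx := integrable_vertical_line hF hx fun z hz => hA z (by rw [hz]; exact ⟨le_rfl, hxy⟩)
  have hIy := integrable_vertical_line hF hy fun z hz => hA z (by rw [hz]; exact ⟨hxy, le_rfl⟩)
  have hA0 : 0 ≤ A := by
    have h1 := (norm_nonneg _).trans (hA x ⟨by simp, by simpa using hxy⟩)
    have h2 : 0 < ‖(x : ℂ)‖ ^ (-2 : ℝ) := Real.rpow_pos_of_pos (by simpa using hx.ne') _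
    exact nonneg_of_mul_nonneg_left h1 h2
  have hrect : ∀ R : ℝ, ((∫ u in x..y, F (u + (-R : ℝ) * Complex.I)) -
      ∫ u in x..y, F (u + R * Complex.I)) + Complex.I • (∫ ω in (-R)..R, F (y + ω * Complex.I)) -
      Complex.I • (∫ ω in (-R)..R, F (x + ω * Complex.I)) = 0 := fun R => by
    have h := Complex.integral_boundary_rect_eq_zero_of_differentiableOn F (x + (-R : ℝ) * Complex.I)
      (y + R * Complex.I) (fun z hz => ?_)
    · simpa using h
    · have h1 : z.re ∈ uIcc x y := by simpa using hz.1
      rw [uIcc_of_le hxy] at h1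
      exact (hF z (hx.trans_le h1.1)).differentiableWithinAt
  have hedge : ∀ R : ℝ, R ≠ 0 → ‖∫ u in x..y, F (u + R * Complex.I)‖ ≤
      A * |R| ^ (-2 : ℝ) * |y - x| := fun R hR => by
    refine intervalIntegral.norm_integral_le_of_norm_le_const fun u hu => ?_
    rw [uIoc_of_le hxy] at hu
    refine (hA _ (by simpa using ⟨hu.1.le, hu.2⟩)).trans (mul_le_mul_of_nonneg_left ?_ hA0)
    refine Real.rpow_le_rpow_of_nonpos (abs_pos.2 hR) ?_ (by norm_num)
    simpa using Complex.abs_im_le_norm ((u : ℂ) + R * Complex.I)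
  have hlim0 : Tendsto (fun R : ℝ => A * |R| ^ (-2 : ℝ) * |y - x|) atTop (nhds 0) := by
    have h1 := ((tendsto_rpow_neg_atTop two_pos).const_mul A).mul_const |y - x|
    rw [mul_zero, zero_mul] at h1
    refine h1.congr' ?_
    filter_upwards [eventually_ge_atTop 0] with R hR
    rw [abs_of_nonneg hR]
  have hl1 : Tendsto (fun R : ℝ => ∫ u in x..y, F (u + R * Complex.I)) atTop (nhds 0) := by
    refine squeeze_zero_norm' ?_ hlim0
    filter_upwards [eventually_gt_atTop 0] with R hR using hedge R hR.ne'
  have hl2 : Tendsto (fun R : ℝ => ∫ u in x..y, F (u + (-R : ℝ) * Complex.I)) atTop (nhds 0) := by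
    refine squeeze_zero_norm' ?_ hlim0
    filter_upwards [eventually_gt_atTop 0] with R hR
    simpa using hedge (-R) (neg_ne_zero.2 hR.ne')
  have hl3 := intervalIntegral_tendsto_integral hIy tendsto_neg_atTop_atBot tendsto_id
  have hl4 := intervalIntegral_tendsto_integral hIx tendsto_neg_atTop_atBot tendsto_id
  have hl := ((hl2.sub hl1).add (hl3.const_smul Complex.I)).sub (hl4.const_smul Complex.I)
  have h0 := tendsto_nhds_unique (hl.congr hrect) tendsto_const_nhds
  rw [sub_zero, zero_add, ← smul_sub, smul_eq_zero, or_iff_right Complex.I_ne_zero, sub_eq_zero]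
    at h0
  exact h0.symm

variable {b b' : ℝ → ℝ} {ρ θ l : ℝ} {s s' : ℝ → ℝ}

/-- Bromwich inversion formula on a line far to the right. -/
lemma IsScalarSolution.exists_inversion (hs : IsScalarSolution b l s s')
    (hb : Assumption1 b b' ρ) (h2 : Assumption2 b ρ θ) (hl : 0 < l) :
    ∃ M : ℝ, 0 < M ∧ ∀ x t : ℝ, M < x → 0 ≤ t → ((t * s t : ℝ) : ℂ) = (2 * Real.pi)⁻¹ *
      ∫ ω : ℝ, Complex.exp ((x + ω * Complex.I) * t) * momentSymbol b l (x + ω * Complex.I) := by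
  obtain ⟨M, hM, hM2⟩ := hb.exists_exponent hl
  refine ⟨M, hM, fun x t hx ht => ?_⟩
  have hx0 : 0 < x := hM.trans hx
  obtain ⟨C, hC, hG⟩ := hb.exists_momentSymbol_le h2 hl le_rfl zero_le_one
  have hGd := fun z hz => differentiableAt_momentSymbol hb h2 (z := z) hz hl.le
  have hGi : Integrable fun ω : ℝ => momentSymbol b l (x + ω * Complex.I) := by
    refine integrable_vertical_line hGd (A := 2 * C) hx0 fun z hz => ?_
    have := hG l le_rfl z (by rw [hz]; exact hx0)
    simp only [neg_zero, Real.rpow_zero, mul_zero, zero_sub, mul_one] at this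
    linarith
  set f : ℝ → ℂ := fun u => Complex.exp (-x * u) * ((max u 0 * s (max u 0) : ℝ) : ℂ) with hf
  have hfc : Continuous f := by
    have h1 : Continuous fun u : ℝ => s (max u 0) :=
      hs.cont.comp_continuous (continuous_id.max continuous_const) fun u => mem_Ici.2 (le_max_right _ _)
    have h2 : Continuous fun u : ℝ => max u 0 := continuous_id.max continuous_const
    exact (Continuous.cexp (by fun_prop)).mul (Complex.continuous_ofReal.comp (h2.mul h1))
  have hf0 : ∀ u ∉ Ioi (0 : ℝ), f u = 0 := fun u hu => by
    have hu' : u ≤ 0 := not_lt.1 (mt mem_Ioi.2 hu)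
    simp [hf, max_eq_right hu']
  have hfi : Integrable f := by
    rw [← integrableOn_iff_integrable_of_support_subset
      (s := Ioi (0 : ℝ)) (fun u hu => by_contra fun h => hu (hf0 u h))]
    have hε : 0 < (x - M) / 2 := by linarith
    refine ((integrableOn_rpow_mul_exp_neg_mul_rpow (s := 1) (p := 1) (b := x - M) (by norm_num)
      one_pos (by linarith)).const_mul 2).mono' hfc.aestronglyMeasurable ?_
    filter_upwards [ae_restrict_mem measurableSet_Ioi] with u hu
    have hu' : 0 < u := hu
    have h3 := hs.abs_le_exp hb hl hM hM2 hu'.le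
    have h1 : ‖Complex.exp (-x * u)‖ = Real.exp (-(x * u)) := by
      rw [Complex.norm_exp]; simp
    simp only [hf]
    rw [norm_mul, h1, Complex.norm_real, Real.norm_eq_abs, max_eq_left hu'.le, abs_mul,
      abs_of_pos hu', Real.rpow_one]
    calc Real.exp (-(x * u)) * (u * |s u|)
        ≤ Real.exp (-(x * u)) * (u * (2 * Real.exp (M * u))) := by gcongr
      _ = 2 * (u * Real.exp (-(x - M) * u)) := by
        have : Real.exp (-(x - M) * u) = Real.exp (-(x * u)) * Real.exp (M * u) := by
          rw [← Real.exp_add]; congr 1; ring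
        rw [this]; ring
  have hFT : ∀ v : ℝ, FourierTransform.fourier f v =
      momentSymbol b l (x + ((2 * Real.pi * v : ℝ) : ℂ) * Complex.I) := fun v => by
    rw [Real.fourier_real_eq_integral_exp_smul,
      ← hs.laplace_moment_eq hb h2 hl hM hM2 (by simpa using hx), laplaceTransform,
      ← setIntegral_eq_integral_of_forall_compl_eq_zero (s := Ioi (0 : ℝ))
        (fun u hu => by rw [hf0 u hu, smul_zero])]
    refine setIntegral_congr_fun measurableSet_Ioi fun u hu => ?_
    simp only [hf, smul_eq_mul]
    rw [max_eq_left (le_of_lt hu), ← mul_assoc, ← Complex.exp_add]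
    congr 2
    push_cast
    ring
  have hFi : Integrable (FourierTransform.fourier f) :=
    (hGi.comp_mul_left' (R := 2 * Real.pi) (by positivity)).congr
      (Eventually.of_forall fun v => (hFT v).symm)
  have hinv := hfi.fourierInv_fourier_eq hFi (hfc.continuousAt (x := t))
  rw [Real.fourierInv_eq'] at hinv
  simp only [hFT] at hinv
  have hsub : ∫ v : ℝ, Complex.exp (((2 * Real.pi * inner ℝ v t : ℝ) : ℂ) * Complex.I) •
      momentSymbol b l (x + ((2 * Real.pi * v : ℝ) : ℂ) * Complex.I) = (2 * Real.pi)⁻¹ *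
      ∫ ω : ℝ, Complex.exp (ω * Complex.I * t) * momentSymbol b l (x + ω * Complex.I) := by
    have h := Measure.integral_comp_mul_left (fun ω : ℝ => Complex.exp (ω * Complex.I * t) *
      momentSymbol b l (x + ω * Complex.I)) (2 * Real.pi)
    rw [abs_of_pos (by positivity), Complex.real_smul] at h
    push_cast at h ⊢
    rw [← h]
    refine integral_congr_ae (Eventually.of_forall fun v => ?_)
    simp only [smul_eq_mul, RCLike.inner_apply, conj_trivial]
    congr 2
    push_cast
    ring
  rw [hsub] at hinv
  simp only [hf, max_eq_left ht] at hinv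
  have he : Complex.exp (x * t) * Complex.exp (-x * t) = 1 := by
    rw [← Complex.exp_add]; simp
  have h4 : ((t * s t : ℝ) : ℂ) = Complex.exp (x * t) * ((2 * Real.pi)⁻¹ *
      ∫ ω : ℝ, Complex.exp (ω * Complex.I * t) * momentSymbol b l (x + ω * Complex.I)) := by
    rw [hinv, ← mul_assoc, he, one_mul]
  rw [h4, mul_left_comm, ← integral_const_mul]
  congr 2
  ext ω
  rw [← mul_assoc, ← Complex.exp_add]
  congr 2
  ring

/-- Bromwich inversion formula on an arbitrary line in the right half plane. -/
lemma IsScalarSolution.inversion (hs : IsScalarSolution b l s s') (hb : Assumption1 b b' ρ)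
    (h2 : Assumption2 b ρ θ) (hl : 0 < l) {x t : ℝ} (hx : 0 < x) (ht : 0 ≤ t) :
    ((t * s t : ℝ) : ℂ) = (2 * Real.pi)⁻¹ *
      ∫ ω : ℝ, Complex.exp ((x + ω * Complex.I) * t) * momentSymbol b l (x + ω * Complex.I) := by
  obtain ⟨M, hM, hinv⟩ := hs.exists_inversion hb h2 hl
  obtain ⟨C, hC, hG⟩ := hb.exists_momentSymbol_le h2 hl le_rfl zero_le_one
  have hxy : x ≤ max x (M + 1) := le_max_left _ _
  rw [hinv (max x (M + 1)) t (lt_of_lt_of_le (lt_add_one M) (le_max_right _ _)) ht]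
  congr 1
  refine (integral_vertical_line_eq (F := fun z => Complex.exp (z * t) * momentSymbol b l z)
    (A := Real.exp (max x (M + 1) * t) * (2 * C)) (fun z hz => ?_) hx hxy fun z hz => ?_).symm
  · exact (differentiableAt_id.mul_const (t : ℂ)).cexp.mul
      (differentiableAt_momentSymbol hb h2 hz hl.le)
  · have h3 := hG l le_rfl z (hx.trans_le hz.1)
    simp only [neg_zero, Real.rpow_zero, mul_zero, zero_sub, mul_one] at h3
    have h4 : ‖Complex.exp (z * t)‖ ≤ Real.exp (max x (M + 1) * t) := by
      rw [Complex.norm_exp, Complex.re_mul_ofReal]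
      exact Real.exp_le_exp.2 (mul_le_mul_of_nonneg_right hz.2 ht)
    rw [norm_mul, mul_assoc]
    exact mul_le_mul h4 (by linarith) (norm_nonneg _) (Real.exp_pos _).le

end Inversion

section Regularity

lemma norm_cexp_sub_cexp_le {z : ℂ} {t r κ : ℝ} (hrt : r ≤ t) (hκ : 0 ≤ κ)
    (hκ1 : κ ≤ 1) (hz : 0 ≤ z.re) :
    ‖Complex.exp (z * t) - Complex.exp (z * r)‖ ≤
      2 * Real.exp (z.re * t) * (‖z‖ * (t - r)) ^ κ := by
  have hn : ∀ u : ℝ, ‖Complex.exp (z * u)‖ = Real.exp (z.re * u) := fun u => by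
    rw [Complex.norm_exp, Complex.re_mul_ofReal]
  have hrt' : Real.exp (z.re * r) ≤ Real.exp (z.re * t) :=
    Real.exp_le_exp.2 (mul_le_mul_of_nonneg_left hrt hz)
  have ha : 0 ≤ ‖z‖ * (t - r) := mul_nonneg (norm_nonneg _) (sub_nonneg.2 hrt)
  rcases le_total (‖z‖ * (t - r)) 1 with h | h
  · have h1 : Complex.exp (z * t) - Complex.exp (z * r) =
        Complex.exp (z * r) * (Complex.exp (z * (t - r)) - 1) := by
      rw [mul_sub, ← Complex.exp_add]; congr 2 <;> ring
    have h2 : ‖z * ((t : ℂ) - r)‖ = ‖z‖ * (t - r) := by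
      rw [norm_mul, ← Complex.ofReal_sub, Complex.norm_real, Real.norm_of_nonneg (sub_nonneg.2 hrt)]
    have h3 : ‖Complex.exp (z * (t - r)) - 1‖ ≤ 2 * (‖z‖ * (t - r)) := by
      rw [← h2]; exact Complex.norm_exp_sub_one_le (by rw [h2]; exact h)
    have h4 : ‖z‖ * (t - r) ≤ (‖z‖ * (t - r)) ^ κ := by
      simpa using Real.rpow_le_rpow_of_exponent_ge' ha h hκ hκ1
    rw [h1, norm_mul, hn]
    calc Real.exp (z.re * r) * ‖Complex.exp (z * (t - r)) - 1‖
        ≤ Real.exp (z.re * t) * (2 * (‖z‖ * (t - r)) ^ κ) := by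
          refine mul_le_mul hrt' (h3.trans ?_) (norm_nonneg _) (Real.exp_pos _).le
          linarith
      _ = _ := by ring
  · have h1 := norm_sub_le (Complex.exp (z * t)) (Complex.exp (z * r))
    rw [hn, hn] at h1
    have h2 : 1 ≤ (‖z‖ * (t - r)) ^ κ := Real.one_le_rpow h hκ
    have h3 := Real.exp_pos (z.re * t)
    nlinarith

variable {b b' : ℝ → ℝ} {ρ θ : ℝ}

lemma Assumption1.exists_moment_sub_le (hb : Assumption1 b b' ρ) (h2 : Assumption2 b ρ θ)
    {l₀ η κ : ℝ} (hl₀ : 0 < l₀) (h0 : 0 ≤ η) (h1 : η ≤ 1) (hκ : 0 ≤ κ) (hκη : κ + ρ * η < 1) :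
    ∃ C > 0, ∀ l : ℝ, l₀ ≤ l → ∀ s s' : ℝ → ℝ, IsScalarSolution b l s s' → ∀ t r : ℝ, 0 < t →
      0 ≤ r → r ≤ t → |t * s t - r * s r| ≤
        C * l ^ (-η) * ((t - r) ^ κ * (t ^ (1 - κ) * (t ^ (-(ρ * η)) + 1))) := by
  obtain ⟨hρ1, hρ2⟩ := hb.rho_mem
  obtain ⟨C, hC, hG⟩ := hb.exists_momentSymbol_le h2 hl₀ h0 h1
  have hδ : 0 ≤ ρ * η := by positivity
  set δ := ρ * η with hδdef
  set I : ℝ → ℝ := fun p => ∫ ω : ℝ, ‖((1 : ℝ) : ℂ) + ω * Complex.I‖ ^ (-p) with hI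
  have hI0 : ∀ p, 0 ≤ I p := fun p => integral_nonneg fun ω => by positivity
  set J := I (2 - κ - δ) + I (2 - κ) with hJ
  have hJ0 : 0 ≤ J := add_nonneg (hI0 _) (hI0 _)
  refine ⟨2 * Real.exp 1 * C * J + 1, by positivity, fun l hl s s' hs t r ht hr hrt => ?_⟩
  have hl' : 0 < l := hl₀.trans_le hl
  have hx : 0 < 1 / t := by positivity
  have hGd := fun z hz => differentiableAt_momentSymbol hb h2 (z := z) hz hl'.le
  have hh : 0 ≤ t - r := sub_nonneg.2 hrt
  set x := 1 / t with hxdef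
  set A := 2 * Real.exp 1 * (t - r) ^ κ * (C * l ^ (-η)) with hA
  have hA0 : 0 ≤ A := by positivity
  have hint : ∀ u : ℝ, 0 ≤ u → Integrable fun ω : ℝ =>
      Complex.exp ((x + ω * Complex.I) * u) * momentSymbol b l (x + ω * Complex.I) := fun u hu => by
    obtain ⟨C', hC', hG'⟩ := hb.exists_momentSymbol_le h2 hl' le_rfl zero_le_one
    refine integrable_vertical_line (F := fun z => Complex.exp (z * u) * momentSymbol b l z)
      (A := Real.exp (x * u) * (2 * C'))
      (fun z hz => (differentiableAt_id.mul_const (u : ℂ)).cexp.mul (hGd z hz)) hx fun z hz => ?_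
    have h3 := hG' l le_rfl z (by rw [hz]; exact hx)
    simp only [neg_zero, Real.rpow_zero, mul_zero, zero_sub, mul_one] at h3
    rw [norm_mul, Complex.norm_exp, Complex.re_mul_ofReal, hz, mul_assoc]
    exact mul_le_mul_of_nonneg_left (by linarith) (Real.exp_pos _).le
  have hpt : ∀ ω : ℝ, ‖Complex.exp ((x + ω * Complex.I) * t) * momentSymbol b l (x + ω * Complex.I) -
      Complex.exp ((x + ω * Complex.I) * r) * momentSymbol b l (x + ω * Complex.I)‖ ≤
      A * (‖(x : ℂ) + ω * Complex.I‖ ^ (-(2 - κ - δ)) + ‖(x : ℂ) + ω * Complex.I‖ ^ (-(2 - κ))) :=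
    fun ω => by
    have hre : ((x : ℂ) + ω * Complex.I).re = x := by simp
    have hz := norm_ofReal_add_mul_I_pos hx ω
    have e1 := norm_cexp_sub_cexp_le (z := x + ω * Complex.I) hrt hκ (by linarith)
      (by rw [hre]; exact hx.le)
    have e2 := hG l hl (x + ω * Complex.I) (by rw [hre]; exact hx)
    rw [hre, hxdef, one_div_mul_cancel ht.ne', ← hxdef, Real.mul_rpow hz.le hh] at e1
    rw [← sub_mul, norm_mul]
    set n := ‖(x : ℂ) + ω * Complex.I‖
    calc _ ≤ 2 * Real.exp 1 * (n ^ κ * (t - r) ^ κ) *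
          (C * l ^ (-η) * (n ^ (δ - 2) + n ^ (-2 : ℝ))) :=
          mul_le_mul e1 e2 (norm_nonneg _) (by positivity)
      _ = A * (n ^ κ * n ^ (δ - 2) + n ^ κ * n ^ (-2 : ℝ)) := by rw [hA]; ring
      _ = _ := by
          rw [← Real.rpow_add hz, ← Real.rpow_add hz]
          congr 3 <;> ring
  have hi1 := integrable_norm_add_mul_I_rpow (p := 2 - κ - δ) (by linarith) hx
  have hi2 := integrable_norm_add_mul_I_rpow (p := 2 - κ) (by linarith) hx
  have hmain : ‖((t * s t - r * s r : ℝ) : ℂ)‖ ≤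
      A * (x ^ (1 - (2 - κ - δ)) * I (2 - κ - δ) + x ^ (1 - (2 - κ)) * I (2 - κ)) := by
    rw [Complex.ofReal_sub, hs.inversion hb h2 hl' hx ht.le, hs.inversion hb h2 hl' hx hr, ← mul_sub,
      ← integral_sub (hint t ht.le) (hint r hr), norm_mul, Complex.norm_real,
      Real.norm_of_nonneg (by positivity)]
    have hle := norm_integral_le_of_norm_le ((hi1.add hi2).const_mul A) (Eventually.of_forall hpt)
    simp only [Pi.add_apply] at hle
    rw [integral_const_mul, integral_add hi1 hi2, integral_norm_add_mul_I_rpow hx,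
      integral_norm_add_mul_I_rpow hx] at hle
    refine le_trans (mul_le_of_le_one_left (norm_nonneg _) ?_) hle
    exact inv_le_one_of_one_le₀ (by linarith [Real.pi_gt_three])
  rw [Complex.norm_real, Real.norm_eq_abs] at hmain
  have hx1 : x ^ (1 - (2 - κ - δ)) = t ^ (1 - κ) * t ^ (-δ) := by
    rw [hxdef, one_div, Real.inv_rpow ht.le, ← Real.rpow_neg ht.le, ← Real.rpow_add ht]
    congr 1; ring
  have hx2 : x ^ (1 - (2 - κ)) = t ^ (1 - κ) := by
    rw [hxdef, one_div, Real.inv_rpow ht.le, ← Real.rpow_neg ht.le]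
    congr 1; ring
  rw [hx1, hx2] at hmain
  have ht1 : 0 ≤ t ^ (1 - κ) := Real.rpow_nonneg ht.le _
  have ht2 : 0 ≤ t ^ (-δ) := Real.rpow_nonneg ht.le _
  have hle1 : I (2 - κ - δ) ≤ J := by have := hI0 (2 - κ); linarith
  have hle2 : I (2 - κ) ≤ J := by have := hI0 (2 - κ - δ); linarith
  calc |t * s t - r * s r|
      ≤ A * (t ^ (1 - κ) * t ^ (-δ) * I (2 - κ - δ) + t ^ (1 - κ) * I (2 - κ)) := hmain
    _ ≤ A * (t ^ (1 - κ) * t ^ (-δ) * J + t ^ (1 - κ) * J) := by gcongr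
    _ = 2 * Real.exp 1 * C * J * l ^ (-η) * ((t - r) ^ κ * (t ^ (1 - κ) * (t ^ (-δ) + 1))) := by
        rw [hA]; ring
    _ ≤ _ := by gcongr; linarith

lemma Assumption1.exists_solution_bounds (hb : Assumption1 b b' ρ) (h2 : Assumption2 b ρ θ)
    {l₀ η κ : ℝ} (hl₀ : 0 < l₀) (h0 : 0 ≤ η) (h1 : η ≤ 1) (hκ : 0 < κ) (hκη : κ + ρ * η < 1) :
    ∃ C > 0, ∀ l : ℝ, l₀ ≤ l → ∀ s s' : ℝ → ℝ, IsScalarSolution b l s s' →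
      (∀ t : ℝ, 0 < t → |s t| ≤ C * l ^ (-η) * (t ^ (-(ρ * η)) + 1)) ∧
      ∀ t r : ℝ, 0 < r → r ≤ t →
        |s t - s r| ≤ C * l ^ (-η) * (((t - r) / t) ^ κ * (r ^ (-(ρ * η)) + 1)) := by
  obtain ⟨hρ1, hρ2⟩ := hb.rho_mem
  obtain ⟨C, hC, hC'⟩ := hb.exists_moment_sub_le h2 hl₀ h0 h1 hκ.le hκη
  have hδ : 0 ≤ ρ * η := by positivity
  set δ := ρ * η with hδdef
  refine ⟨2 * C, by positivity, fun l hl s s' hs => ?_⟩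
  have hl' : 0 < l := hl₀.trans_le hl
  have hln : 0 ≤ l ^ (-η) := Real.rpow_nonneg hl'.le _
  have hbd : ∀ t : ℝ, 0 < t → |s t| ≤ C * l ^ (-η) * (t ^ (-δ) + 1) := fun t ht => by
    have h := hC' l hl s s' hs t 0 ht le_rfl ht.le
    rw [sub_zero, zero_mul, sub_zero, abs_mul, abs_of_pos ht, ← mul_assoc (t ^ κ),
      ← Real.rpow_add ht, add_sub_cancel, Real.rpow_one, mul_left_comm] at h
    exact le_of_mul_le_mul_left h ht
  refine ⟨fun t ht => (hbd t ht).trans ?_, fun t r hr hrt => ?_⟩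
  · have : 0 ≤ t ^ (-δ) := Real.rpow_nonneg ht.le _
    gcongr
    linarith
  · have ht : 0 < t := hr.trans_le hrt
    have h := hC' l hl s s' hs t r ht hr.le hrt
    have hh : 0 ≤ t - r := sub_nonneg.2 hrt
    have hq0 : 0 ≤ (t - r) / t := by positivity
    have hq1 : (t - r) / t ≤ 1 := by rw [div_le_one ht]; linarith
    have hq : (t - r) / t ≤ ((t - r) / t) ^ κ := by
      have := Real.rpow_le_rpow_of_exponent_ge' hq0 hq1 hκ.le (show κ ≤ 1 by linarith)
      rwa [Real.rpow_one] at this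
    have hδt : t ^ (-δ) ≤ r ^ (-δ) := Real.rpow_le_rpow_of_nonpos hr hrt (by linarith)
    have hδr : 0 ≤ r ^ (-δ) := Real.rpow_nonneg hr.le _
    have e : s t - s r = (t * s t - r * s r) / t - (t - r) / t * s r := by field_simp; ring
    have e2 : (t - r) ^ κ * (t ^ (1 - κ) * (t ^ (-δ) + 1)) / t =
        ((t - r) / t) ^ κ * (t ^ (-δ) + 1) := by
      rw [Real.div_rpow hh ht.le, Real.rpow_sub ht, Real.rpow_one]
      field_simp
    calc |s t - s r| ≤ |t * s t - r * s r| / t + (t - r) / t * |s r| := by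
          rw [e]
          refine (abs_sub _ _).trans_eq ?_
          rw [abs_div, abs_of_pos ht, abs_mul, abs_of_nonneg hq0]
      _ ≤ C * l ^ (-η) * ((t - r) ^ κ * (t ^ (1 - κ) * (t ^ (-δ) + 1))) / t +
          ((t - r) / t) ^ κ * (C * l ^ (-η) * (r ^ (-δ) + 1)) := by
          have := hbd r hr
          gcongr
      _ = C * l ^ (-η) * (((t - r) / t) ^ κ * (t ^ (-δ) + 1)) +
          ((t - r) / t) ^ κ * (C * l ^ (-η) * (r ^ (-δ) + 1)) := by rw [← e2]; ring
      _ ≤ C * l ^ (-η) * (((t - r) / t) ^ κ * (r ^ (-δ) + 1)) +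
          ((t - r) / t) ^ κ * (C * l ^ (-η) * (r ^ (-δ) + 1)) := by gcongr
      _ = _ := by ring

end Regularity

section Weights

lemma integrableOn_exp_neg_mul_pow (m : ℕ) :
    IntegrableOn (fun u : ℝ => Real.exp (-u) * u ^ m) (Ioi 0) := by
  have h := Real.GammaIntegral_convergent (s := (m : ℝ) + 1) (by positivity)
  refine h.congr_fun (fun u _ => ?_) measurableSet_Ioi
  simp

lemma integral_exp_neg_mul_pow (m : ℕ) :
    ∫ u in Ioi (0 : ℝ), Real.exp (-u) * u ^ m = (m.factorial : ℝ) := by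
  have h := Real.Gamma_eq_integral (s := (m : ℝ) + 1) (by positivity)
  rw [← Real.Gamma_nat_eq_factorial, h]
  refine setIntegral_congr_fun measurableSet_Ioi fun u _ => ?_
  simp

/-- Scale-invariant majorant of the increments `|s(t) - s(ty)|` of the scalar solutions. -/
def incrementWeight (κ δ y : ℝ) : ℝ := (|1 - y| / max 1 y) ^ κ * (min 1 y) ^ (-δ)

variable {κ δ : ℝ}

lemma increment_ratio_le_one {y : ℝ} (hy : 0 < y) : |1 - y| / max 1 y ≤ 1 := by
  rw [div_le_one (by positivity), abs_le]
  constructor <;> linarith [le_max_left 1 y, le_max_right 1 y]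

lemma incrementWeight_le {y : ℝ} (hy : 0 < y) {k : ℝ} (hk : 1 ≤ k) (hκ : 0 < κ) (hκ1 : κ ≤ 1)
    (hδ : 0 ≤ δ) (hδ1 : δ ≤ 1) :
    incrementWeight κ δ y ≤ 4 * k ^ (-(κ / 2)) * (1 + k * ((1 - y) ^ 2 / y)) := by
  have hk0 : 0 < k := by linarith
  have hm : 0 < min 1 y := lt_min one_pos hy
  have hM : 0 < max 1 y := lt_max_of_lt_left one_pos
  have ha0 : 0 ≤ |1 - y| / max 1 y := by positivity
  have hQ : 0 ≤ (1 - y) ^ 2 / y := by positivity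
  have hkk : 0 < k ^ (-(κ / 2)) := Real.rpow_pos_of_pos hk0 _
  unfold incrementWeight
  rcases le_or_gt (1 / 2) y with h | h
  · have h1 : (min 1 y) ^ (-δ) ≤ 2 := by
      have e1 : (min 1 y) ^ (-δ) ≤ (1 / 2 : ℝ) ^ (-δ) :=
        Real.rpow_le_rpow_of_nonpos (by norm_num) (le_min (by norm_num) h) (by linarith)
      have e2 : (1 / 2 : ℝ) ^ (-δ) ≤ (1 / 2 : ℝ) ^ (-1 : ℝ) :=
        Real.rpow_le_rpow_of_exponent_ge (by norm_num) (by norm_num) (by linarith)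
      rw [Real.rpow_neg_one] at e2
      linarith
    have h2 : (|1 - y| / max 1 y) ^ κ ≤ k ^ (-(κ / 2)) * (1 + k * ((1 - y) ^ 2 / y)) := by
      have e1 : (|1 - y| / max 1 y) ^ κ = ((|1 - y| / max 1 y) ^ 2) ^ (κ / 2) := by
        rw [← Real.rpow_natCast, ← Real.rpow_mul ha0]
        congr 1
        push_cast
        ring
      have e2 : (|1 - y| / max 1 y) ^ 2 ≤ (1 - y) ^ 2 / y := by
        rw [div_pow, sq_abs]
        refine div_le_div_of_nonneg_left (by positivity) hy ?_
        nlinarith [le_max_left 1 y, le_max_right 1 y]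
      have e3 : ((1 - y) ^ 2 / y) ^ (κ / 2)
          = k ^ (-(κ / 2)) * (k * ((1 - y) ^ 2 / y)) ^ (κ / 2) := by
        rw [Real.mul_rpow hk0.le hQ, ← mul_assoc, ← Real.rpow_add hk0]
        simp
      have e4 : (k * ((1 - y) ^ 2 / y)) ^ (κ / 2) ≤ 1 + k * ((1 - y) ^ 2 / y) := by
        have hz : 0 ≤ k * ((1 - y) ^ 2 / y) := by positivity
        calc (k * ((1 - y) ^ 2 / y)) ^ (κ / 2) ≤ (1 + k * ((1 - y) ^ 2 / y)) ^ (κ / 2) :=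
              Real.rpow_le_rpow hz (by linarith) (by linarith)
          _ ≤ (1 + k * ((1 - y) ^ 2 / y)) ^ (1 : ℝ) :=
              Real.rpow_le_rpow_of_exponent_le (by linarith) (by linarith)
          _ = _ := Real.rpow_one _
      rw [e1]
      refine (Real.rpow_le_rpow (by positivity) e2 (by linarith)).trans ?_
      rw [e3]
      gcongr
    have h3 : 0 ≤ (|1 - y| / max 1 y) ^ κ := by positivity
    have h4 : 0 ≤ k ^ (-(κ / 2)) * (1 + k * ((1 - y) ^ 2 / y)) := by positivity
    nlinarith [mul_le_mul h2 h1 (Real.rpow_nonneg hm.le _) h4]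
  · have h1 : (|1 - y| / max 1 y) ^ κ ≤ 1 := Real.rpow_le_one ha0 (increment_ratio_le_one hy) hκ.le
    have h2 : (min 1 y) ^ (-δ) ≤ 1 / y := by
      rw [min_eq_right (by linarith), one_div, ← Real.rpow_neg_one]
      exact Real.rpow_le_rpow_of_exponent_ge hy (by linarith) (by linarith)
    have h3 : 1 / y ≤ 4 * ((1 - y) ^ 2 / y) := by
      rw [← mul_div_assoc]
      gcongr
      nlinarith
    have h4 : k⁻¹ ≤ k ^ (-(κ / 2)) := by
      rw [← Real.rpow_neg_one]
      exact Real.rpow_le_rpow_of_exponent_le hk (by linarith)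
    have h5 : (1 - y) ^ 2 / y = k⁻¹ * (k * ((1 - y) ^ 2 / y)) := by
      field_simp
    calc (|1 - y| / max 1 y) ^ κ * (min 1 y) ^ (-δ) ≤ 1 * (1 / y) := by gcongr
      _ ≤ 4 * (k⁻¹ * (k * ((1 - y) ^ 2 / y))) := by rw [← h5]; linarith
      _ ≤ 4 * (k ^ (-(κ / 2)) * (1 + k * ((1 - y) ^ 2 / y))) := by
          gcongr
          linarith
      _ = _ := by ring

lemma incrementWeight_le_one_add {y : ℝ} (hy : 0 < y) (hκ : 0 < κ) :
    incrementWeight κ δ y ≤ 1 + y ^ (-δ) := by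
  have ha0 : 0 ≤ |1 - y| / max 1 y := by positivity
  have h1 : (|1 - y| / max 1 y) ^ κ ≤ 1 := Real.rpow_le_one ha0 (increment_ratio_le_one hy) hκ.le
  have h2 : (min 1 y) ^ (-δ) ≤ 1 + y ^ (-δ) := by
    have := Real.rpow_nonneg hy.le (-δ)
    rcases le_total 1 y with h | h
    · rw [min_eq_left h, Real.one_rpow]; linarith
    · rw [min_eq_right h]; linarith
  have hm : 0 < min 1 y := lt_min one_pos hy
  calc incrementWeight κ δ y ≤ 1 * (1 + y ^ (-δ)) := by
        unfold incrementWeight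
        gcongr
    _ = _ := one_mul _

/-- The Gamma densities of the quadrature average the increment weight to order `k ^ (-κ/2)`. -/
lemma exists_majorant_incrementWeight (hκ : 0 < κ) (hκ1 : κ ≤ 1) (hδ : 0 ≤ δ) (hδ1 : δ < 1) :
    ∃ C > 0, ∀ k : ℕ, 1 ≤ k → ∃ g : ℝ → ℝ, IntegrableOn g (Ioi 0) ∧
      (∀ u, 0 < u → Real.exp (-u) * u ^ (k - 1) / ((k - 1).factorial : ℝ) *
        incrementWeight κ δ (u / k) ≤ g u) ∧
      ∫ u in Ioi 0, g u ≤ C * (k : ℝ) ^ (-(κ / 2)) := by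
  have hG : 0 < Real.Gamma (1 - δ) := Real.Gamma_pos_of_pos (by linarith)
  refine ⟨12 + Real.Gamma (1 - δ), by positivity, fun k hk => ?_⟩
  obtain rfl | ⟨m, rfl⟩ : k = 1 ∨ ∃ m, k = m + 2 := by
    rcases k with _ | _ | m
    · omega
    · exact Or.inl rfl
    · exact Or.inr ⟨m, rfl⟩
  · have i1 := integrableOn_exp_neg_mul_pow 0
    have i2 := Real.GammaIntegral_convergent (s := 1 - δ) (by linarith)
    refine ⟨fun u => Real.exp (-u) * u ^ 0 + Real.exp (-u) * u ^ (1 - δ - 1), i1.add i2,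
      fun u hu => ?_, ?_⟩
    · have := incrementWeight_le_one_add (κ := κ) (δ := δ) hu hκ
      have he : (1 - δ - 1 : ℝ) = -δ := by ring
      simp only [he, Nat.cast_one, div_one, Nat.sub_self, pow_zero, mul_one,
        Nat.factorial_zero]
      rw [show Real.exp (-u) + Real.exp (-u) * u ^ (-δ) = Real.exp (-u) * (1 + u ^ (-δ)) by ring]
      gcongr
    · rw [integral_add i1 i2, integral_exp_neg_mul_pow, ← Real.Gamma_eq_integral (by linarith)]
      simp
  · have hf : 0 < ((m + 1).factorial : ℝ) := by positivity
    set k : ℝ := ((m + 2 : ℕ) : ℝ) with hkdef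
    have hkm : k = m + 2 := by rw [hkdef]; push_cast; ring
    have hk1 : 1 ≤ k := by rw [hkm]; linarith [Nat.cast_nonneg (α := ℝ) m]
    have hk0 : 0 < k := by linarith
    have i0 := (integrableOn_exp_neg_mul_pow m).const_mul (k ^ 2)
    have i1 := (integrableOn_exp_neg_mul_pow (m + 1)).const_mul (1 - 2 * k)
    have i2 := integrableOn_exp_neg_mul_pow (m + 2)
    have i01 : IntegrableOn (fun u : ℝ => k ^ 2 * (Real.exp (-u) * u ^ m) +
        (1 - 2 * k) * (Real.exp (-u) * u ^ (m + 1))) (Ioi 0) := i0.add i1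
    have i012 : IntegrableOn (fun u : ℝ => k ^ 2 * (Real.exp (-u) * u ^ m) +
        (1 - 2 * k) * (Real.exp (-u) * u ^ (m + 1)) + Real.exp (-u) * u ^ (m + 2)) (Ioi 0) :=
      i01.add i2
    refine ⟨fun u => 4 * k ^ (-(κ / 2)) / ((m + 1).factorial : ℝ) *
      (k ^ 2 * (Real.exp (-u) * u ^ m) + (1 - 2 * k) * (Real.exp (-u) * u ^ (m + 1))
        + Real.exp (-u) * u ^ (m + 2)), i012.const_mul _, fun u hu => ?_, ?_⟩
    · have h := incrementWeight_le (κ := κ) (δ := δ) (div_pos hu hk0) hk1 hκ hκ1 hδ hδ1.le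
      have hd : 0 ≤ Real.exp (-u) * u ^ (m + 1) / ((m + 1).factorial : ℝ) := by positivity
      refine (mul_le_mul_of_nonneg_left h hd).trans (le_of_eq ?_)
      field_simp
      ring
    · rw [integral_const_mul, integral_add i01 i2, integral_add i0 i1, integral_const_mul,
        integral_const_mul, integral_exp_neg_mul_pow, integral_exp_neg_mul_pow,
        integral_exp_neg_mul_pow]
      have hf0 : 0 < (m.factorial : ℝ) := by positivity
      have e : 4 * k ^ (-(κ / 2)) / ((m + 1).factorial : ℝ) *
          (k ^ 2 * m.factorial + (1 - 2 * k) * (m + 1).factorial + (m + 2).factorial)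
          = 4 * k ^ (-(κ / 2)) * (1 + k / (k - 1)) := by
        have h1 : ((m + 1).factorial : ℝ) = (k - 1) * m.factorial := by
          rw [Nat.factorial_succ, hkm]; push_cast; ring
        have h2 : ((m + 2).factorial : ℝ) = k * ((k - 1) * m.factorial) := by
          rw [Nat.factorial_succ, Nat.cast_mul, h1]
        have h3 : k - 1 ≠ 0 := by
          rw [hkm]; have := Nat.cast_nonneg (α := ℝ) m; intro h; linarith
        rw [h1, h2]
        field_simp
        ring
      have h2 : k / (k - 1) ≤ 2 := by
        have := Nat.cast_nonneg (α := ℝ) m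
        rw [div_le_iff₀ (by linarith)]
        linarith
      have hkk : 0 < k ^ (-(κ / 2)) := Real.rpow_pos_of_pos hk0 _
      rw [e]
      nlinarith [mul_pos hG hkk]

lemma sum_rpow_neg_le {p : ℝ} (hp : 0 ≤ p) (hp1 : p < 1) (n : ℕ) :
    ∑ k ∈ Finset.range n, ((k : ℝ) + 1) ^ (-p) ≤ (n : ℝ) ^ (1 - p) / (1 - p) := by
  induction n with
  | zero => simp [Real.zero_rpow (by linarith : 1 - p ≠ 0)]
  | succ n ih =>
    rw [Finset.sum_range_succ]
    have hn : (0 : ℝ) < (n : ℝ) + 1 := by positivity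
    have hq : 0 < 1 - p := by linarith
    have h := rpow_one_add_le_one_add_mul_self (s := -(1 / ((n : ℝ) + 1)))
      (by rw [neg_le_neg_iff, div_le_one hn]; linarith [Nat.cast_nonneg (α := ℝ) n])
      hq.le (by linarith : 1 - p ≤ 1)
    have e1 : (1 : ℝ) + -(1 / ((n : ℝ) + 1)) = n / (n + 1) := by field_simp; ring
    rw [e1, Real.div_rpow (Nat.cast_nonneg n) hn.le, div_le_iff₀ (by positivity)] at h
    have e2 : ((n : ℝ) + 1) ^ (-p) * ((n : ℝ) + 1) = ((n : ℝ) + 1) ^ (1 - p) := by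
      rw [← Real.rpow_add_one hn.ne']
      congr 1
      ring
    have e3 : (1 + (1 - p) * -(1 / ((n : ℝ) + 1))) * ((n : ℝ) + 1) ^ (1 - p)
        = ((n : ℝ) + 1) ^ (1 - p) - (1 - p) * ((n : ℝ) + 1) ^ (-p) := by
      rw [← e2]
      field_simp
      ring
    rw [e3] at h
    push_cast
    calc _ ≤ (n : ℝ) ^ (1 - p) / (1 - p) + ((n : ℝ) + 1) ^ (-p) := by gcongr
      _ ≤ _ := by
        rw [le_div_iff₀ hq, add_mul, div_mul_cancel₀ _ hq.ne']
        linarith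

end Weights

lemma Assumption1.exists_increment_le {b b' : ℝ → ℝ} {ρ θ : ℝ} (hb : Assumption1 b b' ρ)
    (h2 : Assumption2 b ρ θ) {l₀ η κ T : ℝ} (hl₀ : 0 < l₀) (h0 : 0 ≤ η) (h1 : η ≤ 1)
    (hκ : 0 < κ) (hκη : κ + ρ * η < 1) (hT : 0 < T) :
    ∃ C > 0, ∀ l : ℝ, l₀ ≤ l → ∀ s s' : ℝ → ℝ, IsScalarSolution b l s s' →
      ∀ t y : ℝ, 0 < t → t ≤ T → 0 < y →
        |s t - s (t * y)| ≤
          C * t ^ (-(ρ * η)) * incrementWeight κ (ρ * η) y * l ^ (-η) := by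
  obtain ⟨C, hC, hbd⟩ := hb.exists_solution_bounds h2 hl₀ h0 h1 hκ hκη
  have hδ : 0 ≤ ρ * η := mul_nonneg (by linarith [hb.rho_mem.1]) h0
  set δ := ρ * η
  refine ⟨C * (1 + T ^ δ), by positivity, fun l hl s s' hs t y ht htT hy => ?_⟩
  have key : ∀ m : ℝ, 0 < m → m ≤ 1 →
      (t * m) ^ (-δ) + 1 ≤ (1 + T ^ δ) * (t ^ (-δ) * m ^ (-δ)) := by
    intro m hm hm1
    have htm : 0 < t * m := by positivity
    rw [← Real.mul_rpow ht.le hm.le]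
    have e1 : (1 : ℝ) = (t * m) ^ δ * (t * m) ^ (-δ) := by
      rw [← Real.rpow_add htm]; simp
    have e2 : (t * m) ^ δ ≤ T ^ δ :=
      Real.rpow_le_rpow htm.le (by nlinarith) hδ
    have e3 := mul_le_mul_of_nonneg_right e2 (Real.rpow_nonneg htm.le (-δ))
    linarith
  have hlη : 0 ≤ l ^ (-η) := Real.rpow_nonneg (by linarith) _
  unfold incrementWeight
  rcases le_total y 1 with h | h
  · have e := (hbd l hl s s' hs).2 t (t * y) (by positivity) (by nlinarith)
    have er : (t - t * y) / t = |1 - y| / max 1 y := by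
      rw [max_eq_left h, abs_of_nonneg (by linarith)]
      field_simp
    have hr0 : 0 ≤ |1 - y| / max 1 y := by positivity
    rw [er] at e
    rw [min_eq_right h]
    calc |s t - s (t * y)| ≤ _ := e
      _ ≤ C * l ^ (-η) * ((|1 - y| / max 1 y) ^ κ * ((1 + T ^ δ) * (t ^ (-δ) * y ^ (-δ)))) := by
          gcongr
          exact key y hy h
      _ = _ := by ring
  · have e := (hbd l hl s s' hs).2 (t * y) t ht (by nlinarith)
    have er : (t * y - t) / (t * y) = |1 - y| / max 1 y := by
      rw [max_eq_right h, abs_of_nonpos (by linarith)]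
      field_simp
      ring
    have hr0 : 0 ≤ |1 - y| / max 1 y := by positivity
    rw [er, abs_sub_comm] at e
    rw [min_eq_left h]
    have k1 := key 1 one_pos le_rfl
    rw [mul_one] at k1
    calc |s t - s (t * y)| ≤ _ := e
      _ ≤ C * l ^ (-η) * ((|1 - y| / max 1 y) ^ κ * ((1 + T ^ δ) * (t ^ (-δ) * 1 ^ (-δ)))) := by
          gcongr
      _ = _ := by ring

section HilbertBasis

variable {H : Type*} [NormedAddCommGroup H] [InnerProductSpace ℝ H] (e : HilbertBasis ℕ ℝ H)

lemma HilbertBasis.hasSum_smul_and_norm_sq {c : ℕ → ℝ} (hc : Summable fun k => c k ^ 2) :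
    Summable (fun k => c k • e k) ∧ ‖∑' k, c k • e k‖ ^ 2 = ∑' k, c k ^ 2 := by
  have hmem : Memℓp c 2 := by
    refine memℓp_gen ?_
    simpa using hc
  let f : lp (fun _ : ℕ => ℝ) 2 := ⟨c, hmem⟩
  have h := e.hasSum_repr_symm f
  refine ⟨h.summable, ?_⟩
  have h' : ∑' k, c k • e k = e.repr.symm f := h.tsum_eq
  rw [h', LinearIsometryEquiv.norm_map]
  have := lp.norm_rpow_eq_tsum (p := 2) (by simp) f
  simpa [f] using this

lemma HilbertBasis.norm_tsum_smul_le {c v : ℕ → ℝ} {K : ℝ} (hv : Summable fun k => v k ^ 2)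
    (hK : 0 ≤ K) (h : ∀ k, |c k| ≤ K * v k) :
    Summable (fun k => c k • e k) ∧ ‖∑' k, c k • e k‖ ≤ K * √(∑' k, v k ^ 2) := by
  have hle : ∀ k, c k ^ 2 ≤ K ^ 2 * v k ^ 2 := fun k => by
    rw [← mul_pow, ← sq_abs]
    exact pow_le_pow_left₀ (abs_nonneg _) (h k) 2
  have hs := hv.mul_left (K ^ 2)
  have hc : Summable fun k => c k ^ 2 := Summable.of_nonneg_of_le (fun k => sq_nonneg _) hle hs
  obtain ⟨h1, h2⟩ := e.hasSum_smul_and_norm_sq hc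
  refine ⟨h1, ?_⟩
  refine abs_le_of_sq_le_sq' ?_ (by positivity) |>.2
  rw [h2, mul_pow, Real.sq_sqrt (tsum_nonneg fun k => sq_nonneg _), ← tsum_mul_left]
  exact hc.tsum_le_tsum hle hs

lemma Sop_zero {s : ℕ → ℝ → ℝ} (hs : ∀ k, s k 0 = 1) (x : H) : Sop e s 0 x = x := by
  have h := (e.hasSum_repr x).tsum_eq
  simp only [e.repr_apply_apply] at h
  simpa [Sop, hs, real_inner_comm] using h

lemma aestronglyMeasurable_Sop {s : ℕ → ℝ → ℝ} {x : H}
    (hs : ∀ k, ContinuousOn (s k) (Ici 0))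
    (hsum : ∀ t, 0 < t → Summable fun k => (s k t * ⟪x, e k⟫) • e k) {h : ℝ} (hh : 0 < h) :
    AEStronglyMeasurable (fun u => Sop e s (h * u) x) (volume.restrict (Ioi 0)) := by
  refine aestronglyMeasurable_of_tendsto_ae atTop
    (f := fun n u => ∑ k ∈ Finset.range n, (s k (h * u) * ⟪x, e k⟫) • e k) (fun n => ?_) ?_
  · refine ContinuousOn.aestronglyMeasurable ?_ measurableSet_Ioi
    refine continuousOn_finsetSum _ fun k _ => ?_
    have : ContinuousOn (fun u => s k (h * u)) (Ioi 0) :=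
      (hs k).comp (by fun_prop) fun u hu => (mul_pos hh hu).le
    exact (this.mul continuousOn_const).smul continuousOn_const
  · filter_upwards [ae_restrict_mem measurableSet_Ioi] with u hu
    exact (hsum _ (mul_pos hh hu)).hasSum.tendsto_sum_nat

end HilbertBasis

lemma norm_sub_quadB_le {H : Type*} [NormedAddCommGroup H] [NormedSpace ℝ H] [CompleteSpace H]
    {F : ℝ → H} {g : ℝ → ℝ} {h M : ℝ} {k : ℕ}
    (hF : AEStronglyMeasurable (fun u => F (h * u)) (volume.restrict (Ioi 0)))
    (hg : IntegrableOn g (Ioi 0)) (y : H)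
    (hle : ∀ u, 0 < u → Real.exp (-u) * u ^ (k - 1) / ((k - 1).factorial : ℝ) *
      ‖y - F (h * u)‖ ≤ M * g u) :
    ‖y - quadB h F k‖ ≤ M * ∫ u in Ioi 0, g u := by
  set d : ℝ → ℝ := fun u => Real.exp (-u) * u ^ (k - 1) / ((k - 1).factorial : ℝ) with hd
  have hdi : IntegrableOn d (Ioi 0) := (integrableOn_exp_neg_mul_pow (k - 1)).div_const _
  have hd1 : ∫ u in Ioi 0, d u = 1 := by
    rw [hd, integral_div, integral_exp_neg_mul_pow, div_self (by positivity)]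
  have hdm : Continuous d := by fun_prop
  have hae : ∀ᵐ u ∂volume.restrict (Ioi (0 : ℝ)), ‖d u • (y - F (h * u))‖ ≤ M * g u := by
    filter_upwards [ae_restrict_mem measurableSet_Ioi] with u hu
    have hu' : 0 < u := hu
    rw [norm_smul, Real.norm_of_nonneg (by positivity)]
    exact hle u hu
  have hi : IntegrableOn (fun u => d u • (y - F (h * u))) (Ioi 0) :=
    (hg.const_mul M).mono' (hdm.aestronglyMeasurable.smul
      (aestronglyMeasurable_const.sub hF)) hae
  have hy : IntegrableOn (fun u => d u • y) (Ioi 0) := hdi.smul_const y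
  have hq : y - quadB h F k = ∫ u in Ioi 0, d u • (y - F (h * u)) := by
    have e1 : ∫ u in Ioi 0, d u • y = y := by rw [integral_smul_const, hd1, one_smul]
    have e2 : quadB h F k = ∫ u in Ioi 0, (d u • y - d u • (y - F (h * u))) := by
      unfold quadB
      congr 1
      funext u
      rw [← smul_sub]
      simp [hd]
    rw [e2, integral_sub hy hi, e1]
    abel
  rw [hq, ← integral_const_mul]
  exact norm_integral_le_of_norm_le (hg.const_mul M) hae

section QuadratureError

variable {H : Type*} [NormedAddCommGroup H] [InnerProductSpace ℝ H] {b b' : ℝ → ℝ} {ρ θ : ℝ}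
  {lam : ℕ → ℝ} {s s' : ℕ → ℝ → ℝ}

lemma summable_weight_mul_abs_inner_sq (e : HilbertBasis ℕ ℝ H) (hlam_pos : ∀ k, 0 < lam k)
    (hlam_mono : Monotone lam) {η : ℝ} (h0 : 0 ≤ η) (x : H) :
    Summable fun k => (lam k ^ (-η) * |⟪x, e k⟫|) ^ 2 := by
  have hx : Summable fun k => ⟪x, e k⟫ ^ 2 := by
    have h := e.summable_inner_mul_inner x x
    refine h.congr fun k => ?_
    rw [real_inner_comm x (e k), sq]
  refine Summable.of_nonneg_of_le (fun k => sq_nonneg _) (fun k => ?_)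
    (hx.mul_left ((lam 0 ^ (-η)) ^ 2))
  have hle : lam k ^ (-η) ≤ lam 0 ^ (-η) :=
    Real.rpow_le_rpow_of_nonpos (hlam_pos 0) (hlam_mono (Nat.zero_le k)) (by linarith)
  rw [mul_pow, sq_abs]
  exact mul_le_mul_of_nonneg_right
    (pow_le_pow_left₀ (Real.rpow_nonneg (hlam_pos k).le _) hle 2) (sq_nonneg _)

lemma Assumption1.exists_norm_sub_quadB_le [CompleteSpace H] (hb : Assumption1 b b' ρ)
    (h2 : Assumption2 b ρ θ)
    (e : HilbertBasis ℕ ℝ H) (hlam_pos : ∀ k, 0 < lam k) (hlam_mono : Monotone lam)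
    (hs : ∀ k, IsScalarSolution b (lam k) (s k) (s' k))
    {η κ T : ℝ} (h0 : 0 ≤ η) (h1 : η ≤ 1) (hκ : 0 < κ) (hκη : κ + ρ * η < 1) (hT : 0 < T) :
    ∃ C > 0, ∀ x : H, ∀ h : ℝ, 0 < h → ∀ k : ℕ, 1 ≤ k → k * h ≤ T →
      ‖Sop e s (k * h) x - quadB h (fun u => Sop e s u x) k‖ ≤
        C * ((k * h) ^ (-(ρ * η)) * (k : ℝ) ^ (-(κ / 2))) *
          √(∑' j, (lam j ^ (-η) * |⟪x, e j⟫|) ^ 2) := by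
  obtain ⟨A, hA, hinc⟩ := hb.exists_increment_le h2 (hlam_pos 0) h0 h1 hκ hκη hT
  obtain ⟨D, hD, hsol⟩ := hb.exists_solution_bounds h2 (hlam_pos 0) h0 h1 hκ hκη
  have hδ : 0 ≤ ρ * η := mul_nonneg (by linarith [hb.rho_mem.1]) h0
  obtain ⟨G, hG, hmaj⟩ := exists_majorant_incrementWeight hκ (by linarith) hδ
    (by linarith : ρ * η < 1)
  refine ⟨A * G, by positivity, fun x h hh k hk hkT => ?_⟩
  have hv := summable_weight_mul_abs_inner_sq e hlam_pos hlam_mono h0 x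
  set N := √(∑' j, (lam j ^ (-η) * |⟪x, e j⟫|) ^ 2) with hN
  have hk0 : (0 : ℝ) < k := by exact_mod_cast hk
  have ht : 0 < k * h := by positivity
  have hl0 : ∀ j, lam 0 ≤ lam j := fun j => hlam_mono (Nat.zero_le j)
  have hsum : ∀ t, 0 < t → Summable fun j => (s j t * ⟪x, e j⟫) • e j := by
    intro t ht
    refine (e.norm_tsum_smul_le hv (K := D * (t ^ (-(ρ * η)) + 1)) (by positivity)
      fun j => ?_).1
    rw [abs_mul]
    have := (hsol (lam j) (hl0 j) (s j) (s' j) (hs j)).1 t ht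
    calc |s j t| * |⟪x, e j⟫| ≤ (D * lam j ^ (-η) * (t ^ (-(ρ * η)) + 1)) * |⟪x, e j⟫| := by
          gcongr
      _ = _ := by ring
  obtain ⟨g, hg, hgle, hgint⟩ := hmaj k hk
  have hF := aestronglyMeasurable_Sop e (fun j => (hs j).cont) hsum hh
  have hM : 0 ≤ A * (k * h) ^ (-(ρ * η)) * N := by positivity
  have hkey : ∀ u, 0 < u → ‖Sop e s (k * h) x - Sop e s (h * u) x‖ ≤
      A * (k * h) ^ (-(ρ * η)) * incrementWeight κ (ρ * η) (u / k) * N := by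
    intro u hu
    have hy : 0 < u / k := by positivity
    have huk : (k * h) * (u / k) = h * u := by field_simp
    have hw : 0 ≤ incrementWeight κ (ρ * η) (u / k) := by unfold incrementWeight; positivity
    have heq : Sop e s (k * h) x - Sop e s (h * u) x =
        ∑' j, ((s j (k * h) - s j (h * u)) * ⟪x, e j⟫) • (e j : H) := by
      unfold Sop
      rw [← (hsum _ ht).tsum_sub (hsum _ (mul_pos hh hu))]
      congr 1
      funext j
      rw [sub_mul, sub_smul]
    rw [heq]
    refine (e.norm_tsum_smul_le hv (by positivity) fun j => ?_).2
    have := hinc (lam j) (hl0 j) (s j) (s' j) (hs j) (k * h) (u / k) ht hkT hy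
    rw [huk] at this
    rw [abs_mul, ← mul_assoc]
    gcongr
  refine (norm_sub_quadB_le (F := fun u => Sop e s u x) (M := A * (k * h) ^ (-(ρ * η)) * N)
    hF hg (Sop e s (k * h) x) fun u hu => ?_).trans ?_
  · have hd : 0 ≤ Real.exp (-u) * u ^ (k - 1) / ((k - 1).factorial : ℝ) := by positivity
    calc _ ≤ Real.exp (-u) * u ^ (k - 1) / ((k - 1).factorial : ℝ) *
          (A * (k * h) ^ (-(ρ * η)) * incrementWeight κ (ρ * η) (u / k) * N) := by
          gcongr
          exact hkey u hu
      _ = A * (k * h) ^ (-(ρ * η)) * N * (Real.exp (-u) * u ^ (k - 1) / ((k - 1).factorial : ℝ) *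
          incrementWeight κ (ρ * η) (u / k)) := by ring
      _ ≤ _ := by
          gcongr
          exact hgle u hu
  · calc _ ≤ A * (k * h) ^ (-(ρ * η)) * N * (G * (k : ℝ) ^ (-(κ / 2))) := by gcongr
      _ = _ := by ring

lemma mul_sum_rpow_le {T δ κ h : ℝ} {n : ℕ} (hh : 0 < h) (hn : (n : ℝ) * h = T) (hδ : 0 ≤ δ)
    (hκ : 0 ≤ κ) (hp : 2 * δ + κ < 1) :
    h * ∑ k ∈ Finset.range n,
        ((((k : ℝ) + 1) * h) ^ (-δ) * ((k : ℝ) + 1) ^ (-(κ / 2))) ^ 2 ≤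
      T ^ (1 - (2 * δ + κ)) / (1 - (2 * δ + κ)) * h ^ κ := by
  have e1 : ∀ k : ℕ, ((((k : ℝ) + 1) * h) ^ (-δ) * ((k : ℝ) + 1) ^ (-(κ / 2))) ^ 2 =
      h ^ (-(2 * δ)) * ((k : ℝ) + 1) ^ (-(2 * δ + κ)) := by
    intro k
    have hk : (0 : ℝ) < (k : ℝ) + 1 := by positivity
    rw [Real.mul_rpow hk.le hh.le, mul_right_comm, ← Real.rpow_add hk, mul_pow,
      ← Real.rpow_mul_natCast hk.le, ← Real.rpow_mul_natCast hh.le, mul_comm]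
    congr 2 <;> push_cast <;> ring
  simp only [e1]
  rw [← Finset.mul_sum, ← mul_assoc]
  have e2 : h * h ^ (-(2 * δ)) = h ^ (1 - (2 * δ + κ)) * h ^ κ := by
    rw [← Real.rpow_add hh, ← Real.rpow_one_add' hh.le (by linarith)]
    congr 1
    ring
  have e3 := sum_rpow_neg_le (p := 2 * δ + κ) (by positivity) hp n
  rw [e2, ← hn, Real.mul_rpow (Nat.cast_nonneg n) hh.le]
  calc _ ≤ h ^ (1 - (2 * δ + κ)) * h ^ κ *
        ((n : ℝ) ^ (1 - (2 * δ + κ)) / (1 - (2 * δ + κ))) := by gcongr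
    _ = _ := by ring

end QuadratureError

/-- the nonsmooth data `ℓ²` error estimate for the time discretization:
`(Δt Σ_{k=0}^n ‖S(t_k)x - B_k x‖²)^{1/2} ≤ C Δt^γ ‖x‖_{σ-1/ρ}` for `0 < σ ≤ 1/ρ`,
`γ < ρσ/2`, `Δt = T/n` (stated in squared form; `B₀ = I`). -/
theorem statement18 {H : Type*} [NormedAddCommGroup H] [InnerProductSpace ℝ H]
    [CompleteSpace H]
    (b b' : ℝ → ℝ) (ρ θ : ℝ) (hb : Assumption1 b b' ρ) (hb2 : Assumption2 b ρ θ)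
    (e : HilbertBasis ℕ ℝ H) (lam : ℕ → ℝ)
    (hlam_pos : ∀ k, 0 < lam k) (hlam_mono : Monotone lam)
    (hlam_top : Tendsto lam atTop atTop)
    (s s' : ℕ → ℝ → ℝ) (hs : ∀ k, IsScalarSolution b (lam k) (s k) (s' k))
    (T σ γ : ℝ) (hT : 0 < T) (hσ0 : 0 < σ) (hσ1 : σ ≤ 1 / ρ) (hγ : γ < ρ * σ / 2) :
    ∃ C > 0, ∀ n : ℕ, 1 ≤ n → ∀ x : H,
      ENNReal.ofReal ((T / (n : ℝ)) * ∑ k ∈ Finset.range (n + 1),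
          ‖Sop e s ((k : ℝ) * (T / (n : ℝ))) x -
              (if k = 0 then x
               else quadB (T / (n : ℝ)) (fun u => Sop e s u x) k)‖ ^ 2) ≤
        ENNReal.ofReal (C ^ 2 * (T / (n : ℝ)) ^ (2 * γ)) *
          ∑' j, ENNReal.ofReal (lam j ^ (σ - 1 / ρ) * ⟪x, e j⟫ ^ 2) := by
  obtain ⟨hρ1, hρ2⟩ := hb.rho_mem
  have hρ : 0 < ρ := by linarith
  have hσρ : ρ * σ ≤ 1 := by
    rw [le_div_iff₀ hρ] at hσ1
    linarith
  have hρσ : 0 < ρ * σ := mul_pos hρ hσ0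
  set η : ℝ := (1 / ρ - σ) / 2 with hη
  have h0 : 0 ≤ η := by rw [hη]; linarith
  have h1 : η ≤ 1 := by
    have : 1 / ρ ≤ 1 := by rw [div_le_one hρ]; exact hρ1.le
    rw [hη]; linarith
  have hδ : ρ * η = (1 - ρ * σ) / 2 := by
    rw [hη]; field_simp
  have hη2 : σ - 1 / ρ = -η * (2 : ℕ) := by rw [hη]; push_cast; ring
  set κ : ℝ := max (2 * γ) (ρ * σ / 2) with hκdef
  have hκ : 0 < κ := lt_max_of_lt_right (by linarith)
  have hκ2 : κ < ρ * σ := max_lt (by linarith) (by linarith)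
  have hκγ : 2 * γ ≤ κ := le_max_left _ _
  have hκη : κ + ρ * η < 1 := by rw [hδ]; linarith
  have hδ0 : 0 ≤ ρ * η := by rw [hδ]; linarith
  have hp : 2 * (ρ * η) + κ < 1 := by rw [hδ]; linarith
  obtain ⟨A, hA, hmain⟩ := hb.exists_norm_sub_quadB_le hb2 e hlam_pos hlam_mono hs h0 h1 hκ hκη hT
  set P : ℝ := T ^ (1 - (2 * (ρ * η) + κ)) / (1 - (2 * (ρ * η) + κ)) with hP
  have hP0 : 0 < P := div_pos (Real.rpow_pos_of_pos hT _) (by linarith)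
  refine ⟨√(A ^ 2 * P * T ^ (κ - 2 * γ)), by positivity, fun n hn x => ?_⟩
  have hn0 : (0 : ℝ) < n := by exact_mod_cast hn
  set h : ℝ := T / n with hh
  have hh0 : 0 < h := by positivity
  have hnh : (n : ℝ) * h = T := by rw [hh]; field_simp
  have hhT : h ≤ T := div_le_self hT.le (by exact_mod_cast hn)
  have hv := summable_weight_mul_abs_inner_sq e hlam_pos hlam_mono h0 x
  have hveq : ∀ j, lam j ^ (σ - 1 / ρ) * ⟪x, e j⟫ ^ 2 = (lam j ^ (-η) * |⟪x, e j⟫|) ^ 2 := by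
    intro j
    rw [mul_pow, sq_abs, hη2, Real.rpow_mul_natCast (hlam_pos j).le]
  simp only [hveq]
  rw [← ENNReal.ofReal_tsum_of_nonneg (fun j => sq_nonneg _) hv,
    ← ENNReal.ofReal_mul (by positivity), Real.sq_sqrt (by positivity)]
  refine ENNReal.ofReal_le_ofReal ?_
  set N : ℝ := ∑' j, (lam j ^ (-η) * |⟪x, e j⟫|) ^ 2 with hN
  have hN0 : 0 ≤ N := tsum_nonneg fun j => sq_nonneg _
  rw [Finset.sum_range_succ']
  have hz : Sop e s (((0 : ℕ) : ℝ) * h) x = x := by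
    rw [Nat.cast_zero, zero_mul]
    exact Sop_zero e (fun k => (hs k).init) x
  rw [if_pos rfl, hz, sub_self, norm_zero]
  have hterm : ∀ k ∈ Finset.range n,
      ‖Sop e s (((k + 1 : ℕ) : ℝ) * h) x - (if k + 1 = 0 then x
        else quadB h (fun u => Sop e s u x) (k + 1))‖ ^ 2 ≤
      A ^ 2 * N * ((((k : ℝ) + 1) * h) ^ (-(ρ * η)) * ((k : ℝ) + 1) ^ (-(κ / 2))) ^ 2 := by
    intro k hk
    have hkn : ((k + 1 : ℕ) : ℝ) ≤ n := by exact_mod_cast Finset.mem_range.1 hk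
    have hkT : ((k + 1 : ℕ) : ℝ) * h ≤ T := by
      rw [← hnh]
      gcongr
    have e1 := hmain x h hh0 (k + 1) (by omega) hkT
    rw [if_neg (Nat.succ_ne_zero k)]
    refine (pow_le_pow_left₀ (norm_nonneg _) e1 2).trans (le_of_eq ?_)
    rw [mul_pow, mul_pow, Real.sq_sqrt hN0]
    push_cast
    ring
  have hsum := mul_sum_rpow_le hh0 hnh hδ0 hκ.le hp
  rw [← hP] at hsum
  have hpow : h ^ κ ≤ T ^ (κ - 2 * γ) * h ^ (2 * γ) := by
    have : h ^ κ = h ^ (κ - 2 * γ) * h ^ (2 * γ) := by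
      rw [← Real.rpow_add hh0]
      congr 1
      ring
    rw [this]
    gcongr
  calc _ ≤ h * (∑ k ∈ Finset.range n, A ^ 2 * N *
        ((((k : ℝ) + 1) * h) ^ (-(ρ * η)) * ((k : ℝ) + 1) ^ (-(κ / 2))) ^ 2) := by
        rw [zero_pow two_ne_zero, add_zero]
        gcongr with k hk
        exact hterm k hk
    _ = A ^ 2 * N * (h * ∑ k ∈ Finset.range n,
        ((((k : ℝ) + 1) * h) ^ (-(ρ * η)) * ((k : ℝ) + 1) ^ (-(κ / 2))) ^ 2) := by
        rw [← Finset.mul_sum]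
        ring
    _ ≤ A ^ 2 * N * (P * (T ^ (κ - 2 * γ) * h ^ (2 * γ))) := by
        refine mul_le_mul_of_nonneg_left (hsum.trans ?_) (by positivity)
        gcongr
    _ = _ := by ring
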